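/- arXiv:2509.01520 — 7 statements merged into one kernel-verified Lean document; each statement's English description precedes it below -/
import Mathlib

section
/- Let G₁ and G₂ be finite simple graphs on a common finite vertex set V, and suppose G₁ is connected. Then G₁ and G₂ are degree-similar if and only if there exists an invertible real matrix M with rows and columns indexed by V such that M⁻¹A(G₁)M = A(G₂), M_{uv} = 0 whenever deg_{G₁}(u) ≠ deg_{G₂}(v), and all row sums and all column sums of M are equal to 1 (i.e., M𝟙 = 𝟙 and Mᵀ𝟙 = 𝟙, where 𝟙 is the all-one vector). -/
open scoped Classical

/-- The diagonal degree matrix of a graph, over `ℝ`. -/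
noncomputable def degMatrix {V : Type*} [Fintype V] [DecidableEq V] (G : SimpleGraph V) :
    Matrix V V ℝ :=
  Matrix.diagonal fun v => (G.degree v : ℝ)

/-- Two graphs on a common vertex set are degree-similar if some invertible real matrix
simultaneously conjugates the adjacency matrix of one to that of the other, and the
degree matrix of one to that of the other. -/
noncomputable def DegreeSimilar {V : Type*} [Fintype V] [DecidableEq V]
    (G₁ G₂ : SimpleGraph V) : Prop :=
  ∃ M : Matrix V V ℝ, IsUnit M.det ∧
    M⁻¹ * G₁.adjMatrix ℝ * M = G₂.adjMatrix ℝ ∧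
    M⁻¹ * degMatrix G₁ * M = degMatrix G₂

theorem inv_mul_mul_eq_iff_mul_eq_mul {V : Type*} [Fintype V] [DecidableEq V]
    {M : Matrix V V ℝ} (hM : IsUnit M.det) (A B : Matrix V V ℝ) :
    M⁻¹ * A * M = B ↔ A * M = M * B := by
  constructor
  · rintro rfl
    rw [Matrix.mul_assoc, Matrix.mul_nonsing_inv_cancel_left _ _ hM]
  · intro h
    rw [Matrix.mul_assoc, h, Matrix.nonsing_inv_mul_cancel_left _ _ hM]

theorem degMatrix_mul_eq_mul_degMatrix_iff {V : Type*} [Fintype V] [DecidableEq V]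
    (G₁ G₂ : SimpleGraph V) (M : Matrix V V ℝ) :
    degMatrix G₁ * M = M * degMatrix G₂ ↔
      ∀ u v : V, G₁.degree u ≠ G₂.degree v → M u v = 0 := by
  simp only [← Matrix.ext_iff, degMatrix, Matrix.diagonal_mul, Matrix.mul_diagonal,
    mul_comm (M _ _), mul_eq_mul_right_iff, Nat.cast_inj, or_iff_not_imp_left, ne_eq]

theorem SimpleGraph.Connected.exists_eq_const_of_lapMatrix_mulVec_eq_zero {V : Type*}
    [Fintype V] [DecidableEq V] {G : SimpleGraph V} (hG : G.Connected) {x : V → ℝ}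
    (hx : (G.lapMatrix ℝ).mulVec x = 0) : ∃ c : ℝ, x = fun _ => c := by
  obtain ⟨w⟩ := hG.nonempty
  exact ⟨x w, funext fun v =>
    G.lapMatrix_mulVec_eq_zero_iff_forall_reachable.mp hx v w (hG.preconnected v w)⟩

/-- A matrix intertwining the Laplacian of a connected graph with another Laplacian
has constant and equal row and column sums. -/
theorem exists_rowSum_colSum_eq_of_lapMatrix_mul {V : Type*} [Fintype V] [DecidableEq V]
    {G₁ G₂ : SimpleGraph V} (hG : G₁.Connected) {M : Matrix V V ℝ} (hM : IsUnit M.det)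
    (h : G₁.lapMatrix ℝ * M = M * G₂.lapMatrix ℝ) :
    ∃ c : ℝ, c ≠ 0 ∧ M.mulVec (fun _ => (1 : ℝ)) = (fun _ => c) ∧
      M.vecMul (fun _ => (1 : ℝ)) = (fun _ => c) := by
  have hinj : Function.Injective M.mulVec :=
    Matrix.mulVec_injective_of_isUnit ((Matrix.isUnit_iff_isUnit_det M).mpr hM)
  have hker {x : V → ℝ} (hx : (G₂.lapMatrix ℝ).mulVec x = 0) :
      ∃ c : ℝ, M.mulVec x = fun _ => c := by
    refine hG.exists_eq_const_of_lapMatrix_mulVec_eq_zero ?_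
    rw [Matrix.mulVec_mulVec, h, ← Matrix.mulVec_mulVec, hx, Matrix.mulVec_zero]
  obtain ⟨c, hc⟩ := hker G₂.lapMatrix_mulVec_const_eq_zero
  have : Nonempty V := hG.nonempty
  have hc0 : c ≠ 0 := by
    rintro rfl
    have h0 : (fun _ : V => (1 : ℝ)) = 0 := hinj (by rw [hc, Matrix.mulVec_zero]; rfl)
    exact one_ne_zero (congrFun h0 (Classical.arbitrary V))
  have hcol : (G₂.lapMatrix ℝ).mulVec (Matrix.vecMul (fun _ => (1 : ℝ)) M) = 0 := by
    rw [← Matrix.vecMul_transpose, (G₂.isSymm_lapMatrix (R := ℝ)).eq, Matrix.vecMul_vecMul, ← h,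
      ← Matrix.vecMul_vecMul, ← Matrix.mulVec_transpose (G₁.lapMatrix ℝ),
      (G₁.isSymm_lapMatrix (R := ℝ)).eq, G₁.lapMatrix_mulVec_const_eq_zero, Matrix.zero_vecMul]
  obtain ⟨d, hd⟩ := hker hcol
  have hconst : Matrix.vecMul (fun _ => (1 : ℝ)) M = fun _ => d / c := by
    apply hinj
    have : (fun _ : V => d / c) = (d / c) • fun _ : V => (1 : ℝ) := by ext; simp
    rw [hd, this, Matrix.mulVec_smul, hc]
    ext
    simp [hc0]
  have hsum := Matrix.dotProduct_mulVec (fun _ => (1 : ℝ)) M (fun _ => (1 : ℝ))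
  rw [hc, hconst] at hsum
  have hdc : c = d / c := by simpa [dotProduct] using hsum
  exact ⟨c, hc0, hc, hdc ▸ hconst⟩

theorem stmt1 {V : Type*} [Fintype V] [DecidableEq V] (G₁ G₂ : SimpleGraph V)
    (hconn : G₁.Connected) :
    DegreeSimilar G₁ G₂ ↔
      ∃ M : Matrix V V ℝ, IsUnit M.det ∧
        M⁻¹ * G₁.adjMatrix ℝ * M = G₂.adjMatrix ℝ ∧
        (∀ u v : V, G₁.degree u ≠ G₂.degree v → M u v = 0) ∧
        M.mulVec (fun _ => (1 : ℝ)) = (fun _ => 1) ∧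
        M.vecMul (fun _ => (1 : ℝ)) = (fun _ => 1) := by
  constructor
  · rintro ⟨M, hM, hA, hD⟩
    rw [inv_mul_mul_eq_iff_mul_eq_mul hM] at hA hD
    have hL : G₁.lapMatrix ℝ * M = M * G₂.lapMatrix ℝ := by
      change (degMatrix G₁ - _) * M = M * (degMatrix G₂ - _)
      rw [Matrix.sub_mul, Matrix.mul_sub, hA, hD]
    obtain ⟨c, hc, hrow, hcol⟩ := exists_rowSum_colSum_eq_of_lapMatrix_mul hconn hM hL
    have hcM : IsUnit (c⁻¹ • M).det := by
      rw [Matrix.det_smul]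
      exact ((inv_ne_zero hc).isUnit.pow _).mul hM
    refine ⟨c⁻¹ • M, hcM, ?_, ?_, ?_, ?_⟩
    · rw [inv_mul_mul_eq_iff_mul_eq_mul hcM, Matrix.mul_smul, Matrix.smul_mul, hA]
    · rw [← degMatrix_mul_eq_mul_degMatrix_iff, Matrix.mul_smul, Matrix.smul_mul, hD]
    · rw [Matrix.smul_mulVec, hrow]
      ext
      simp [hc]
    · rw [Matrix.vecMul_smul, hcol]
      ext
      simp [hc]
  · rintro ⟨M, hM, hA, hD, -, -⟩
    exact ⟨M, hM, hA, (inv_mul_mul_eq_iff_mul_eq_mul hM _ _).mpr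
      ((degMatrix_mul_eq_mul_degMatrix_iff G₁ G₂ M).mpr hD)⟩
end

section
/- Let G₁ and G₂ be degree-similar graphs on a common finite vertex set V with identical degree functions (deg_{G₁}(v) = deg_{G₂}(v) for every vertex v), and suppose G₁ is connected. Let c be a symmetric function assigning to each pair of degrees (d,d') one of the three labels keep, complement, empty, and for k = 1,2 let G̃ₖ be the graph on V in which two distinct vertices u, v with d = deg_{G₁}(u) and d' = deg_{G₁}(v) are adjacent exactly when either c(d,d') = keep and u, v are adjacent in Gₖ, or c(d,d') = complement and u, v are non-adjacent in Gₖ (and never when c(d,d') = empty). Then A(G̃₁) and A(G̃₂) have the same characteristic polynomial, and the adjacency matrices of the complements G̃₁ᶜ and G̃₂ᶜ also have the same characteristic polynomial. -/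
open scoped Classical

/-- The three possible operations on a block of the adjacency matrix determined by
a pair of degree classes: keep it, complement it, or replace it by a zero block. -/
inductive BlockLabel : Type
  | keep : BlockLabel
  | complement : BlockLabel
  | empty : BlockLabel

/-- Matrices intertwined by an invertible matrix have the same characteristic polynomial. -/
theorem Matrix.charpoly_eq_of_mul_eq_mul {n R : Type*} [Fintype n] [DecidableEq n] [CommRing R]
    {M X Y : Matrix n n R} (hM : IsUnit M.det) (h : X * M = M * Y) : X.charpoly = Y.charpoly := by
  obtain ⟨U, rfl⟩ := (Matrix.isUnit_iff_isUnit_det M).2 hM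
  rw [← Matrix.charpoly_units_conj U Y, ← h, Matrix.mul_nonsing_inv_cancel_right _ _ hM]

/-- If `M` is block diagonal for the partition into fibres of `f`, then scaling the blocks of
intertwined matrices by common factors keeps them intertwined by `M`. -/
theorem Matrix.of_mul_mul_eq_mul_of_mul {n α R : Type*} [Fintype n] [CommRing R]
    {M X Y : Matrix n n R} {f : n → α} (hM : ∀ u v, f u ≠ f v → M u v = 0)
    (h : X * M = M * Y) (k : α → α → R) :
    (Matrix.of fun u v => k (f u) (f v) * X u v) * M =
      M * Matrix.of fun u v => k (f u) (f v) * Y u v := by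
  ext u v
  have huv : ∑ w, X u w * M w v = ∑ w, M u w * Y w v := congrFun (congrFun h u) v
  simp only [Matrix.mul_apply, Matrix.of_apply]
  calc ∑ w, k (f u) (f w) * X u w * M w v = k (f u) (f v) * ∑ w, X u w * M w v := by
        rw [Finset.mul_sum]
        refine Finset.sum_congr rfl fun w _ => ?_
        by_cases hw : f w = f v
        · rw [hw, mul_assoc]
        · simp [hM w v hw]
    _ = ∑ w, M u w * (k (f w) (f v) * Y w v) := by
        rw [huv, Finset.mul_sum]
        refine Finset.sum_congr rfl fun w _ => ?_
        by_cases hw : f u = f w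
        · rw [hw]; ring
        · simp [hM u w hw]

/-- A vector in the kernel of the Laplacian of a connected graph is constant. -/
theorem SimpleGraph.Connected.exists_eq_of_lapMatrix_mulVec_eq_zero {V : Type*} [Fintype V]
    [DecidableEq V] {G : SimpleGraph V} [DecidableRel G.Adj] (hG : G.Connected) {x : V → ℝ}
    (hx : (G.lapMatrix ℝ).mulVec x = 0) : ∃ a : ℝ, x = fun _ => a := by
  obtain ⟨v⟩ := hG.nonempty
  exact ⟨x v, funext fun w =>
    (G.lapMatrix_mulVec_eq_zero_iff_forall_reachable.1 hx) w v (hG.preconnected w v)⟩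

/-- An invertible matrix intertwining the Laplacians of two graphs, one of them connected,
commutes with the all-ones matrix. -/
theorem SimpleGraph.Connected.allOnes_mul_eq_mul_allOnes {V : Type*} [Fintype V] [DecidableEq V]
    {G₁ G₂ : SimpleGraph V} [DecidableRel G₁.Adj] [DecidableRel G₂.Adj] (hG : G₁.Connected)
    {M : Matrix V V ℝ} (hM : IsUnit M.det)
    (h : G₁.lapMatrix ℝ * M = M * G₂.lapMatrix ℝ) :
    (Matrix.of fun _ _ => 1 : Matrix V V ℝ) * M = M * Matrix.of fun _ _ => 1 := by
  have hT : G₂.lapMatrix ℝ * M.transpose = M.transpose * G₁.lapMatrix ℝ := by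
    have := congrArg Matrix.transpose h
    rw [Matrix.transpose_mul, Matrix.transpose_mul, (G₁.isSymm_lapMatrix (R := ℝ)).eq,
      (G₂.isSymm_lapMatrix (R := ℝ)).eq] at this
    exact this.symm
  have hinj := Matrix.mulVec_injective_iff_isUnit.2 ((Matrix.isUnit_iff_isUnit_det M).2 hM)
  obtain ⟨a, ha⟩ := hG.exists_eq_of_lapMatrix_mulVec_eq_zero (x := M.mulVec fun _ => 1) (by
    rw [Matrix.mulVec_mulVec, h, ← Matrix.mulVec_mulVec, G₂.lapMatrix_mulVec_const_eq_zero,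
      Matrix.mulVec_zero])
  obtain ⟨b, hb⟩ := hG.exists_eq_of_lapMatrix_mulVec_eq_zero
    (x := M.mulVec (M.transpose.mulVec fun _ => 1)) (by
    rw [Matrix.mulVec_mulVec, h, ← Matrix.mulVec_mulVec, Matrix.mulVec_mulVec _ _ M.transpose, hT,
      ← Matrix.mulVec_mulVec, G₁.lapMatrix_mulVec_const_eq_zero, Matrix.mulVec_zero,
      Matrix.mulVec_zero])
  obtain ⟨v₀⟩ := hG.nonempty
  have ha0 : a ≠ 0 := by
    rintro rfl
    have : (fun _ : V => (1 : ℝ)) = 0 := hinj (by rw [ha, Matrix.mulVec_zero]; rfl)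
    simpa using congrFun this v₀
  have hcol : M.transpose.mulVec (fun _ => 1) = fun _ => b / a := hinj (by
    have hconst : (fun _ : V => b / a) = (b / a) • fun _ : V => (1 : ℝ) := by ext; simp
    rw [hb, hconst, Matrix.mulVec_smul, ha]
    ext; simp [ha0])
  have hrow_sum (u : V) : ∑ w, M u w = a := by
    simpa [Matrix.mulVec, dotProduct] using congrFun ha u
  have hcol_sum (v : V) : ∑ w, M w v = b / a := by
    simpa [Matrix.mulVec, dotProduct] using congrFun hcol v
  have hab : b / a = a := by
    have := Finset.sum_comm (s := Finset.univ) (t := Finset.univ) (f := fun u v => M u v)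
    simp only [hrow_sum, hcol_sum, Finset.sum_const, nsmul_eq_mul] at this
    have hcard : ((Finset.univ : Finset V).card : ℝ) ≠ 0 := by
      exact_mod_cast (Finset.card_pos.2 ⟨v₀, Finset.mem_univ v₀⟩).ne'
    exact (mul_left_cancel₀ hcard this).symm
  ext u v
  simp [Matrix.mul_apply, hrow_sum, hcol_sum, hab]

/-- The adjacency matrix of the complement is obtained by subtracting the identity and the
adjacency matrix from the all-ones matrix. -/
theorem SimpleGraph.adjMatrix_compl_eq_allOnes_sub {V R : Type*} [DecidableEq V] [Ring R]
    (G : SimpleGraph V) [DecidableRel G.Adj] [DecidableRel Gᶜ.Adj] :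
    Gᶜ.adjMatrix R = (Matrix.of fun _ _ => 1) - 1 - G.adjMatrix R := by
  ext u v
  by_cases huv : u = v
  · subst huv; simp
  · by_cases h : G.Adj u v <;> simp [SimpleGraph.compl_adj, huv, h]

/-- The adjacency matrix of a graph obtained by keeping, complementing or deleting blocks. -/
theorem adjMatrix_eq_of_blockLabel {V α : Type*} [DecidableEq V] {G H : SimpleGraph V} {f : V → α}
    {c : α → α → BlockLabel}
    (h : ∀ u v : V, H.Adj u v ↔ u ≠ v ∧ ((c (f u) (f v) = BlockLabel.keep ∧ G.Adj u v) ∨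
      (c (f u) (f v) = BlockLabel.complement ∧ ¬ G.Adj u v))) :
    H.adjMatrix ℝ =
      (Matrix.of fun u v => (if c (f u) (f v) = BlockLabel.keep then (1 : ℝ) else 0) *
        G.adjMatrix ℝ u v) +
      Matrix.of fun u v => (if c (f u) (f v) = BlockLabel.complement then (1 : ℝ) else 0) *
        Gᶜ.adjMatrix ℝ u v := by
  ext u v
  simp only [SimpleGraph.adjMatrix_apply, Matrix.add_apply, Matrix.of_apply,
    SimpleGraph.compl_adj, h]
  by_cases huv : u = v
  · subst huv; simp
  · by_cases hG : G.Adj u v <;> cases hc : c (f u) (f v) <;> simp [huv, hG]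

theorem stmt2 {V : Type*} [Fintype V] [DecidableEq V]
    (G₁ G₂ Gt₁ Gt₂ : SimpleGraph V)
    (hds : DegreeSimilar G₁ G₂)
    (hdeg : ∀ v : V, G₁.degree v = G₂.degree v)
    (hconn : G₁.Connected)
    (c : ℕ → ℕ → BlockLabel) (hsymm : ∀ d d' : ℕ, c d d' = c d' d)
    (h1 : ∀ u v : V, Gt₁.Adj u v ↔ u ≠ v ∧
      ((c (G₁.degree u) (G₁.degree v) = BlockLabel.keep ∧ G₁.Adj u v) ∨
       (c (G₁.degree u) (G₁.degree v) = BlockLabel.complement ∧ ¬ G₁.Adj u v)))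
    (h2 : ∀ u v : V, Gt₂.Adj u v ↔ u ≠ v ∧
      ((c (G₁.degree u) (G₁.degree v) = BlockLabel.keep ∧ G₂.Adj u v) ∨
       (c (G₁.degree u) (G₁.degree v) = BlockLabel.complement ∧ ¬ G₂.Adj u v))) :
    (Gt₁.adjMatrix ℝ).charpoly = (Gt₂.adjMatrix ℝ).charpoly ∧
    ((Gt₁ᶜ).adjMatrix ℝ).charpoly = ((Gt₂ᶜ).adjMatrix ℝ).charpoly := by
  obtain ⟨M, hM, hA, hD⟩ := hds
  have hA' : G₁.adjMatrix ℝ * M = M * G₂.adjMatrix ℝ := by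
    rw [← hA, mul_assoc, Matrix.mul_nonsing_inv_cancel_left _ _ hM]
  have hD' : degMatrix G₁ * M = M * degMatrix G₂ := by
    rw [← hD, mul_assoc, Matrix.mul_nonsing_inv_cancel_left _ _ hM]
  have hblock (u v : V) (huv : G₁.degree u ≠ G₁.degree v) : M u v = 0 := by
    have h := congrFun (congrFun hD' u) v
    rw [degMatrix, degMatrix, Matrix.diagonal_mul, Matrix.mul_diagonal, ← hdeg, mul_comm] at h
    by_contra h0
    exact huv (by exact_mod_cast mul_left_cancel₀ h0 h)
  have hJ := hconn.allOnes_mul_eq_mul_allOnes (G₂ := G₂) hM (by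
    have hlap (G : SimpleGraph V) : G.lapMatrix ℝ = degMatrix G - G.adjMatrix ℝ := by
      rw [SimpleGraph.lapMatrix, SimpleGraph.degMatrix, degMatrix]
    rw [hlap, hlap, sub_mul, mul_sub, hA', hD'])
  have hcompl {H₁ H₂ : SimpleGraph V} (h : H₁.adjMatrix ℝ * M = M * H₂.adjMatrix ℝ) :
      H₁ᶜ.adjMatrix ℝ * M = M * H₂ᶜ.adjMatrix ℝ := by
    simp only [SimpleGraph.adjMatrix_compl_eq_allOnes_sub, sub_mul, mul_sub, h, hJ, one_mul,
      mul_one]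
  have hGt : Gt₁.adjMatrix ℝ * M = M * Gt₂.adjMatrix ℝ := by
    rw [adjMatrix_eq_of_blockLabel h1, adjMatrix_eq_of_blockLabel h2, add_mul, mul_add]
    congr 1
    · exact Matrix.of_mul_mul_eq_mul_of_mul hblock hA'
        fun d d' => if c d d' = BlockLabel.keep then 1 else 0
    · exact Matrix.of_mul_mul_eq_mul_of_mul hblock (hcompl hA')
        fun d d' => if c d d' = BlockLabel.complement then 1 else 0
  exact ⟨Matrix.charpoly_eq_of_mul_eq_mul hM hGt, Matrix.charpoly_eq_of_mul_eq_mul hM (hcompl hGt)⟩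
end

section
/- Let G₁ and G₂ be degree-similar graphs on a common finite vertex set V with identical degree functions, G₁ connected, and let G̃₁, G̃₂ be obtained from G₁, G₂ by simultaneously, on each pair of degree classes of the common degree partition, either keeping the corresponding block of the adjacency matrix, replacing it by its complement, or replacing it by a zero block (the same choice for both graphs, as encoded by a symmetric label function c on pairs of degrees). If moreover deg_{G̃₁}(v) = deg_{G̃₂}(v) for every vertex v, and deg_{G̃₁} is constant on each class of the degree partition of G₁ (deg_{G₁}(u) = deg_{G₁}(v) implies deg_{G̃₁}(u) = deg_{G̃₁}(v)), then G̃₁ and G̃₂ are degree-similar. -/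
open scoped Classical

open scoped Matrix

/-- A vector killed by the Laplacian `D - A` of a connected graph is constant. -/
theorem eq_of_adjMatrix_mulVec_eq {V : Type*} [Fintype V] [DecidableEq V]
    {G : SimpleGraph V} (hG : G.Connected) {x : V → ℝ}
    (hx : G.adjMatrix ℝ *ᵥ x = degMatrix G *ᵥ x) (u v : V) : x u = x v := by
  have hL : G.lapMatrix ℝ *ᵥ x = 0 := by
    have hD : G.degMatrix ℝ = degMatrix G := by
      unfold SimpleGraph.degMatrix degMatrix
      congr!
    rw [SimpleGraph.lapMatrix, Matrix.sub_mulVec, hx, hD, sub_self]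
  exact (G.lapMatrix_mulVec_eq_zero_iff_forall_reachable.mp hL) u v (hG.preconnected u v)

/-- The all-ones vector is killed by the Laplacian. -/
theorem adjMatrix_mulVec_one_eq {V : Type*} [Fintype V] [DecidableEq V] (G : SimpleGraph V) :
    G.adjMatrix ℝ *ᵥ 1 = degMatrix G *ᵥ 1 := by
  ext v
  simp only [degMatrix, Matrix.mulVec_diagonal, Pi.one_apply, mul_one]
  rw [SimpleGraph.adjMatrix_mulVec_apply]
  simp

/-- If `M` intertwines the adjacency and degree matrices of two graphs, the first of which is
connected, then all row sums and all column sums of `M` are equal. -/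
theorem exists_sum_eq_of_intertwines {V : Type*} [Fintype V] [DecidableEq V]
    {G₁ G₂ : SimpleGraph V} (hconn : G₁.Connected) {M : Matrix V V ℝ} (hM : IsUnit M.det)
    (hA : G₁.adjMatrix ℝ * M = M * G₂.adjMatrix ℝ)
    (hD : degMatrix G₁ * M = M * degMatrix G₂) :
    ∃ a : ℝ, (∀ u, ∑ v, M u v = a) ∧ ∀ v, ∑ u, M u v = a := by
  obtain ⟨v₀⟩ := hconn.nonempty
  have key : ∀ x : V → ℝ, G₂.adjMatrix ℝ *ᵥ x = degMatrix G₂ *ᵥ x →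
      ∀ u, (M *ᵥ x) u = (M *ᵥ x) v₀ := by
    intro x hx u
    refine eq_of_adjMatrix_mulVec_eq hconn ?_ u v₀
    rw [Matrix.mulVec_mulVec, Matrix.mulVec_mulVec, hA, hD, ← Matrix.mulVec_mulVec, hx,
      Matrix.mulVec_mulVec]
  have hinj : Function.Injective M.mulVec :=
    Matrix.mulVec_injective_iff_isUnit.mpr ((Matrix.isUnit_iff_isUnit_det M).mpr hM)
  have hAt : Mᵀ * G₁.adjMatrix ℝ = G₂.adjMatrix ℝ * Mᵀ := by
    simpa [Matrix.transpose_mul] using congrArg Matrix.transpose hA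
  have hDt : Mᵀ * degMatrix G₁ = degMatrix G₂ * Mᵀ := by
    simpa [Matrix.transpose_mul, degMatrix] using congrArg Matrix.transpose hD
  set a := (M *ᵥ 1) v₀ with ha
  have hrow : M *ᵥ 1 = a • 1 := by
    ext u
    simpa using key 1 (adjMatrix_mulVec_one_eq G₂) u
  have ha0 : a ≠ 0 := by
    intro h0
    have h10 : (1 : V → ℝ) = 0 := hinj (by simp [hrow, h0])
    simpa using congrFun h10 v₀
  have hker : G₂.adjMatrix ℝ *ᵥ (Mᵀ *ᵥ 1) = degMatrix G₂ *ᵥ (Mᵀ *ᵥ 1) := by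
    rw [Matrix.mulVec_mulVec, Matrix.mulVec_mulVec, ← hAt, ← hDt, ← Matrix.mulVec_mulVec,
      adjMatrix_mulVec_one_eq, Matrix.mulVec_mulVec]
  obtain ⟨b, hcol⟩ : ∃ b : ℝ, Mᵀ *ᵥ 1 = b • 1 := by
    refine ⟨(M *ᵥ (Mᵀ *ᵥ 1)) v₀ / a, hinj ?_⟩
    rw [Matrix.mulVec_smul, hrow]
    ext u
    rw [key _ hker u]
    simp [ha0]
  have hr : ∀ u, ∑ v, M u v = a := fun u => by
    simpa [Matrix.mulVec, dotProduct] using congrFun hrow u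
  have hc : ∀ v, ∑ u, M u v = b := fun v => by
    simpa [Matrix.mulVec, dotProduct] using congrFun hcol v
  have hab : a = b := by
    have hsum := Finset.sum_comm (s := Finset.univ) (t := Finset.univ) (f := fun u v => M u v)
    have hcard : (Fintype.card V : ℝ) ≠ 0 :=
      Nat.cast_ne_zero.mpr (Fintype.card_pos_iff.mpr ⟨v₀⟩).ne'
    simpa [hr, hc, hcard] using hsum
  exact ⟨a, hr, hab ▸ hc⟩

theorem stmt3 {V : Type*} [Fintype V] [DecidableEq V]
    (G₁ G₂ Gt₁ Gt₂ : SimpleGraph V)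
    (hds : DegreeSimilar G₁ G₂)
    (hdeg : ∀ v : V, G₁.degree v = G₂.degree v)
    (hconn : G₁.Connected)
    (c : ℕ → ℕ → BlockLabel) (hsymm : ∀ d d' : ℕ, c d d' = c d' d)
    (h1 : ∀ u v : V, Gt₁.Adj u v ↔ u ≠ v ∧
      ((c (G₁.degree u) (G₁.degree v) = BlockLabel.keep ∧ G₁.Adj u v) ∨
       (c (G₁.degree u) (G₁.degree v) = BlockLabel.complement ∧ ¬ G₁.Adj u v)))
    (h2 : ∀ u v : V, Gt₂.Adj u v ↔ u ≠ v ∧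
      ((c (G₁.degree u) (G₁.degree v) = BlockLabel.keep ∧ G₂.Adj u v) ∨
       (c (G₁.degree u) (G₁.degree v) = BlockLabel.complement ∧ ¬ G₂.Adj u v)))
    (hdeg' : ∀ v : V, Gt₁.degree v = Gt₂.degree v)
    (hconst : ∀ u v : V, G₁.degree u = G₁.degree v → Gt₁.degree u = Gt₁.degree v) :
    DegreeSimilar Gt₁ Gt₂ := by
  obtain ⟨M, hM, hA, hD⟩ := hds
  have cancel : ∀ X Y : Matrix V V ℝ, M⁻¹ * X * M = Y → X * M = M * Y := by
    rintro X Y rfl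
    rw [Matrix.mul_assoc, Matrix.mul_nonsing_inv_cancel_left _ _ hM]
  have uncancel : ∀ X Y : Matrix V V ℝ, X * M = M * Y → M⁻¹ * X * M = Y := by
    intro X Y h
    rw [Matrix.mul_assoc, h, Matrix.nonsing_inv_mul_cancel_left _ _ hM]
  have hAM := cancel _ _ hA
  have hDM := cancel _ _ hD
  obtain ⟨a, hrow, hcol⟩ := exists_sum_eq_of_intertwines hconn hM hAM hDM
  have hblock : ∀ u v, G₁.degree u ≠ G₁.degree v → M u v = 0 := by
    intro u v huv
    have h := congrFun (congrFun hDM u) v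
    simp only [degMatrix, Matrix.diagonal_mul, Matrix.mul_diagonal] at h
    have h' : ((G₁.degree u : ℝ) - G₁.degree v) * M u v = 0 := by
      rw [hdeg v]
      linear_combination h
    exact (mul_eq_zero.mp h').resolve_left (sub_ne_zero.mpr (Nat.cast_injective.ne huv))
  refine ⟨M, hM, uncancel _ _ ?_, uncancel _ _ ?_⟩
  · ext u w
    have hAuw := congrFun (congrFun hAM u) w
    rw [Matrix.mul_apply, Matrix.mul_apply] at hAuw ⊢
    have hl : ∀ v, Gt₁.adjMatrix ℝ u v * M v w =
        (match c (G₁.degree u) (G₁.degree w) with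
          | .keep => G₁.adjMatrix ℝ u v
          | .complement => 1 - (if u = v then 1 else 0) - G₁.adjMatrix ℝ u v
          | .empty => 0) * M v w := by
      intro v
      by_cases hvw : G₁.degree v = G₁.degree w
      · congr 1
        simp only [SimpleGraph.adjMatrix_apply, h1, hvw]
        by_cases huv : u = v
        · subst huv
          cases c (G₁.degree u) (G₁.degree w) <;> simp
        · cases c (G₁.degree u) (G₁.degree w) <;> by_cases h : G₁.Adj u v <;> simp [huv, h]
      · rw [hblock v w hvw, mul_zero, mul_zero]
    have hr : ∀ v, M u v * Gt₂.adjMatrix ℝ v w =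
        M u v * (match c (G₁.degree u) (G₁.degree w) with
          | .keep => G₂.adjMatrix ℝ v w
          | .complement => 1 - (if v = w then 1 else 0) - G₂.adjMatrix ℝ v w
          | .empty => 0) := by
      intro v
      by_cases huv : G₁.degree u = G₁.degree v
      · congr 1
        simp only [SimpleGraph.adjMatrix_apply, h2, huv]
        by_cases hvw : v = w
        · subst hvw
          cases c (G₁.degree v) (G₁.degree v) <;> simp
        · cases c (G₁.degree v) (G₁.degree w) <;> by_cases h : G₂.Adj v w <;> simp [hvw, h]
      · rw [hblock u v huv, zero_mul, zero_mul]
    rw [Finset.sum_congr rfl fun v _ => hl v, Finset.sum_congr rfl fun v _ => hr v]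
    cases c (G₁.degree u) (G₁.degree w) with
    | keep => exact hAuw
    | complement =>
      simp only [sub_mul, mul_sub, Finset.sum_sub_distrib, one_mul, mul_one, hrow, hcol, hAuw]
      simp
    | empty => simp
  · ext u w
    simp only [degMatrix, Matrix.diagonal_mul, Matrix.mul_diagonal]
    by_cases huw : G₁.degree u = G₁.degree w
    · rw [← hdeg' w, hconst u w huw, mul_comm]
    · rw [hblock u w huw, mul_zero, zero_mul]
end

section
/- Let m ≥ 0, n = 16 + m, and let G₁ and G₂ be the trees on n vertices obtained from 𝖳 by attaching the path 17–18–⋯–n at vertex 4 and at vertex 7, respectively (for m = 0 both equal 𝖳). Then the n×n matrices tI − L_μ(G₁) and tI − L_μ(G₂) over the polynomial ring ℚ(μ)[t] are equivalent: there exist matrices U and V that are invertible over ℚ(μ)[t] such that U·(tI − L_μ(G₁))·V = tI − L_μ(G₂). Equivalently, tI − L_μ(G₁) and tI − L_μ(G₂) have the same Smith normal form over ℚ(μ)[t]. -/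
open scoped Classical

/-- The edges of the tree `𝖳` on vertices `1, …, 16`: the path `1–2–⋯–9`, the pendant
edges `9–10` and `9–16`, the pendant path `3–11–12`, and the pendant path `6–13–14–15`. -/
def baseEdges : List (ℕ × ℕ) :=
  [(1,2),(2,3),(3,4),(4,5),(5,6),(6,7),(7,8),(8,9),(9,10),(9,16),
   (3,11),(11,12),(6,13),(13,14),(14,15)]

/-- The tree on `m + 16` vertices obtained from `𝖳` by attaching the path
`17–18–⋯–(16+m)` at the vertex `w` of `𝖳`.  Vertex `ℓ ∈ {1, …, 16+m}` is represented
by the element of `Fin (m+16)` with value `ℓ - 1`. -/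
def treeGraph (w m : ℕ) : SimpleGraph (Fin (m + 16)) :=
  SimpleGraph.fromRel (fun i j =>
    (i.val + 1, j.val + 1) ∈ baseEdges ∨
    (i.val + 1 = w ∧ j.val + 1 = 17) ∨
    (17 ≤ i.val + 1 ∧ j.val + 1 = i.val + 2))

/-- The matrix `t I - L_μ(G) = t I - (A(G) - μ D(G))` regarded as a matrix over the
polynomial ring `ℚ(μ)[t]`, realized as `Polynomial (RatFunc ℚ)` with `t = X` and
`μ = C RatFunc.X`. -/
noncomputable def charLmu {n : ℕ} (G : SimpleGraph (Fin n)) :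
    Matrix (Fin n) (Fin n) (Polynomial (RatFunc ℚ)) :=
  (Polynomial.X : Polynomial (RatFunc ℚ)) • (1 : Matrix (Fin n) (Fin n) (Polynomial (RatFunc ℚ))) -
    (G.adjMatrix (Polynomial (RatFunc ℚ)) -
      Polynomial.C (RatFunc.X : RatFunc ℚ) •
        Matrix.diagonal (fun v => (G.degree v : Polynomial (RatFunc ℚ))))

open scoped Matrix

namespace Matrix

variable {n k : Type*} [Fintype n] [DecidableEq n] [Fintype k] [DecidableEq k]
  {R : Type*} [CommRing R]

/-- The reflection negating the column space of `K` and fixing its orthogonal complement. -/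
noncomputable def colReflection (K : Matrix n k R) : Matrix n n R :=
  1 - (2 : R) • (K * (Kᵀ * K)⁻¹ * Kᵀ)

theorem colReflection_transpose (K : Matrix n k R) : (colReflection K)ᵀ = colReflection K := by
  simp [colReflection, transpose_nonsing_inv, Matrix.mul_assoc]

theorem colReflection_mul_self {K : Matrix n k R} (hK : IsUnit (Kᵀ * K).det) :
    colReflection K * colReflection K = 1 := by
  have h : K * (Kᵀ * K)⁻¹ * Kᵀ * (K * (Kᵀ * K)⁻¹ * Kᵀ) = K * (Kᵀ * K)⁻¹ * Kᵀ := by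
    calc _ = K * (Kᵀ * K)⁻¹ * ((Kᵀ * K) * (Kᵀ * K)⁻¹) * Kᵀ := by simp only [Matrix.mul_assoc]
      _ = _ := by rw [mul_nonsing_inv _ hK, Matrix.mul_one]
  simp only [colReflection, Matrix.sub_mul, Matrix.mul_sub, Matrix.one_mul, Matrix.mul_one,
    Matrix.smul_mul, Matrix.mul_smul, h]
  module

theorem commute_colReflection {K : Matrix n k R} (hK : IsUnit (Kᵀ * K).det)
    {L : Matrix n n R} (hL : Lᵀ = L) {M : Matrix k k R} (hLK : L * K = K * M) :
    Commute L (colReflection K) := by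
  have hKL : Kᵀ * L = Mᵀ * Kᵀ := by
    rw [← transpose_mul, ← hLK, transpose_mul, hL]
  have hG : (Kᵀ * K) * M = Mᵀ * (Kᵀ * K) := by
    rw [Matrix.mul_assoc, ← hLK, ← Matrix.mul_assoc, hKL, Matrix.mul_assoc]
  have hM : M * (Kᵀ * K)⁻¹ = (Kᵀ * K)⁻¹ * Mᵀ := by
    calc _ = (Kᵀ * K)⁻¹ * ((Kᵀ * K) * M) * (Kᵀ * K)⁻¹ := by
            rw [← Matrix.mul_assoc, nonsing_inv_mul _ hK, Matrix.one_mul]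
      _ = (Kᵀ * K)⁻¹ * Mᵀ * ((Kᵀ * K) * (Kᵀ * K)⁻¹) := by
            rw [hG]; simp only [Matrix.mul_assoc]
      _ = _ := by rw [mul_nonsing_inv _ hK, Matrix.mul_one]
  have h : L * (K * (Kᵀ * K)⁻¹ * Kᵀ) = K * (Kᵀ * K)⁻¹ * Kᵀ * L := by
    calc _ = (L * K) * (Kᵀ * K)⁻¹ * Kᵀ := by simp only [Matrix.mul_assoc]
      _ = K * (M * (Kᵀ * K)⁻¹) * Kᵀ := by rw [hLK]; simp only [Matrix.mul_assoc]
      _ = K * (Kᵀ * K)⁻¹ * (Mᵀ * Kᵀ) := by rw [hM]; simp only [Matrix.mul_assoc]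
      _ = _ := by rw [← hKL]; simp only [Matrix.mul_assoc]
  unfold Commute SemiconjBy colReflection
  rw [Matrix.mul_sub, Matrix.sub_mul, Matrix.mul_smul, Matrix.smul_mul, h, Matrix.one_mul,
    Matrix.mul_one]

theorem colReflection_mulVec {K : Matrix n k R} (hK : IsUnit (Kᵀ * K).det) {u v : n → R}
    {c : k → R} (hsub : u - v = K *ᵥ c) (hadd : Kᵀ *ᵥ (u + v) = 0) :
    colReflection K *ᵥ u = v := by
  have h1 : (K * (Kᵀ * K)⁻¹ * Kᵀ) *ᵥ (u - v) = u - v := by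
    rw [hsub, mulVec_mulVec, Matrix.mul_assoc, Matrix.mul_assoc, nonsing_inv_mul _ hK,
      Matrix.mul_one]
  have h2 : (K * (Kᵀ * K)⁻¹ * Kᵀ) *ᵥ (u + v) = 0 := by
    rw [← mulVec_mulVec, hadd, mulVec_zero]
  rw [mulVec_sub] at h1
  rw [mulVec_add] at h2
  rw [colReflection, sub_mulVec, one_mulVec, smul_mulVec, two_smul]
  linear_combination -h1 - h2

theorem fromBlocks_mul_fromBlocks_rankOne_mul_fromBlocks {l : Type*} [Fintype l] [DecidableEq l]
    {Q B : Matrix n n R} {u v : n → R} (hQu : Q *ᵥ u = v) (huQ : u ᵥ* Q = v) (hQB : Q * B * Q = B)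
    (c : R) (z : l → R) (D : Matrix l l R) :
    fromBlocks Q 0 0 1 *
        fromBlocks (B + c • vecMulVec u u) (-vecMulVec u z) (-vecMulVec z u) D *
        fromBlocks Q 0 0 1 =
      fromBlocks (B + c • vecMulVec v v) (-vecMulVec v z) (-vecMulVec z v) D := by
  simp [fromBlocks_multiply, Matrix.mul_add, Matrix.add_mul, mul_vecMulVec, vecMulVec_mul,
    hQu, huQ, hQB]

theorem exists_isUnit_det_mul_mul_eq_of_submatrix (e : n ≃ k) {T : Matrix n n R}
    (hT : T * T = 1) {M M' : Matrix k k R}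
    (h : T * M.submatrix e e * T = M'.submatrix e e) :
    ∃ U W : Matrix k k R, IsUnit U.det ∧ IsUnit W.det ∧ U * M * W = M' := by
  have hU : IsUnit (T.submatrix e.symm e.symm).det := by
    rw [det_submatrix_equiv_self]
    exact IsUnit.of_mul_eq_one _ (by rw [← det_mul, hT, det_one])
  refine ⟨_, _, hU, hU, ?_⟩
  have h' := congrArg (fun A => A.submatrix e.symm e.symm) h
  simpa [← submatrix_mul_equiv _ _ _ e.symm] using h'

end Matrix

/-- Adjacency in the tree `𝖳`, with its vertices numbered from `0`. -/
def baseAdj (i j : Fin 16) : Prop :=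
  (i.val + 1, j.val + 1) ∈ baseEdges ∨ (j.val + 1, i.val + 1) ∈ baseEdges

instance : DecidableRel baseAdj := fun _ _ => inferInstanceAs (Decidable (_ ∨ _))

section Base

variable {R : Type*} [CommRing R]

/-- The matrix `A(𝖳) - x D(𝖳)`. -/
def baseL (x : R) : Matrix (Fin 16) (Fin 16) R :=
  Matrix.of (fun i j => if baseAdj i j then (1 : R) else 0) -
    x • Matrix.diagonal (fun i => ∑ j, if baseAdj i j then (1 : R) else 0)

/-- A basis of the `baseL x`-invariant subspace generated by the difference of the unit vectors
at the vertices `4` and `7`. -/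
def antiBasis (x : R) : Matrix (Fin 16) (Fin 5) R :=
  !![1, 0, 0, 0, 0;
     0, 1, 0, 0, 0;
     0, 0, 1, 0, 0;
     0, 0, 0, 1, 0;
     0, 0, 0, 0, 1;
     -1, x, 0, 0, -1;
     0, 0, 0, -1, 0;
     1, -x, -1, 0, 0;
     0, -1, 0, 0, 0;
     -1, 0, 0, 0, 0;
     0, 1, 0, 0, 0;
     1, 0, 0, 0, 0;
     1 - x, x ^ 2 - x - 1, x, 0, -x;
     x, 1 - x ^ 2, -(1 + x), 0, 1 + x;
     -1, x - 1, 1, 0, -1;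
     -1, 0, 0, 0, 0]

/-- The matrix of `baseL x` on the basis `antiBasis x`. -/
def antiAction (x : R) : Matrix (Fin 5) (Fin 5) R :=
  !![-x, 1, 0, 0, 0;
     1, -2 * x, 1, 0, 0;
     0, 2, -3 * x, 1, 0;
     0, 0, 1, -2 * x, 1;
     -1, x, 0, 1, -2 * x - 1]

theorem baseL_transpose (x : R) : (baseL x)ᵀ = baseL x := by
  ext i j
  by_cases h : i = j
  · subst h; rfl
  · have hij : baseAdj j i ↔ baseAdj i j := or_comm
    simp [baseL, h, Ne.symm h, hij]

/-- The neighbours of a vertex of `𝖳`. -/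
def baseNeighbors : Fin 16 → Finset (Fin 16) :=
  ![{1}, {0, 2}, {1, 3, 10}, {2, 4}, {3, 5}, {4, 6, 12}, {5, 7}, {6, 8}, {7, 9, 15}, {8},
    {2, 11}, {10}, {5, 13}, {12, 14}, {13}, {8}]

theorem baseAdj_iff_mem_baseNeighbors : ∀ i j, baseAdj i j ↔ j ∈ baseNeighbors i := by
  decide

theorem baseL_mul_apply {k : Type*} (x : R) (K : Matrix (Fin 16) k R) (i : Fin 16) (j : k) :
    (baseL x * K) i j =
      ∑ l ∈ baseNeighbors i, K l j - x * ((baseNeighbors i).card * K i j) := by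
  rw [baseL, Matrix.sub_mul, Matrix.sub_apply, Matrix.smul_mul, Matrix.smul_apply,
    Matrix.diagonal_mul, Matrix.mul_apply]
  simp [baseAdj_iff_mem_baseNeighbors]

theorem baseL_mul_antiBasis (x : R) : baseL x * antiBasis x = antiBasis x * antiAction x := by
  ext i j
  rw [baseL_mul_apply]
  fin_cases i <;> fin_cases j <;>
    simp [baseNeighbors, antiBasis, antiAction, Matrix.mul_apply, Fin.sum_univ_succ] <;> ring

theorem single_sub_single_eq_antiBasis_mulVec (x : R) :
    (Pi.single 3 1 - Pi.single 6 1 : Fin 16 → R) = antiBasis x *ᵥ Pi.single 3 1 := by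
  ext i
  fin_cases i <;> simp [antiBasis]

theorem antiBasis_transpose_mulVec (x : R) :
    (antiBasis x)ᵀ *ᵥ (Pi.single 3 1 + Pi.single 6 1) = 0 := by
  ext i
  rw [Matrix.mulVec_add]
  fin_cases i <;> simp [antiBasis]

theorem antiBasis_map {S : Type*} [CommRing S] (f : R →+* S) (x : R) :
    (antiBasis x).map f = antiBasis (f x) := by
  ext i j
  fin_cases i <;> fin_cases j <;> simp [antiBasis]

theorem det_antiBasis_gram_map {S : Type*} [CommRing S] (f : R →+* S) (x : R) :
    f ((antiBasis x)ᵀ * antiBasis x).det = ((antiBasis (f x))ᵀ * antiBasis (f x)).det := by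
  rw [RingHom.map_det, RingHom.mapMatrix_apply, Matrix.map_mul, Matrix.transpose_map,
    antiBasis_map]

theorem exists_involution_single_eq_single {x : R}
    (hx : IsUnit ((antiBasis x)ᵀ * antiBasis x).det) :
    ∃ Q : Matrix (Fin 16) (Fin 16) R, Q * Q = 1 ∧ Commute (baseL x) Q ∧
      Q *ᵥ Pi.single 3 1 = Pi.single 6 1 ∧ Pi.single 3 1 ᵥ* Q = Pi.single 6 1 := by
  have h := Matrix.colReflection_mulVec hx (single_sub_single_eq_antiBasis_mulVec x)
    (antiBasis_transpose_mulVec x)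
  refine ⟨(antiBasis x).colReflection, Matrix.colReflection_mul_self hx,
    Matrix.commute_colReflection hx (baseL_transpose x) (baseL_mul_antiBasis x), h, ?_⟩
  rw [← Matrix.mulVec_transpose, Matrix.colReflection_transpose, h]

end Base

theorem antiBasis_gram_zero : (antiBasis (0 : ℚ))ᵀ * antiBasis (0 : ℚ) =
    !![8, 0, -2, 0, 2;
       0, 6, -2, 0, 2;
       -2, -2, 4, 0, -2;
       0, 0, 0, 2, 0;
       2, 2, -2, 0, 4] := by
  ext i j
  fin_cases i <;> fin_cases j <;>
    simp [antiBasis, Matrix.mul_apply, Fin.sum_univ_succ] <;> norm_num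

theorem det_antiBasis_gram_zero_ne_zero :
    ((antiBasis (0 : ℚ))ᵀ * antiBasis (0 : ℚ)).det ≠ 0 := by
  rw [antiBasis_gram_zero]
  simp [Matrix.det_succ_row_zero, Fin.sum_univ_succ, Fin.succAbove]
  norm_num

open Polynomial in
theorem isUnit_det_antiBasis_gram :
    IsUnit ((antiBasis (C (RatFunc.X : RatFunc ℚ)))ᵀ * antiBasis (C (RatFunc.X : RatFunc ℚ))).det := by
  rw [← det_antiBasis_gram_map]
  refine IsUnit.map _ (isUnit_iff_ne_zero.mpr ?_)
  rw [← RatFunc.algebraMap_X, ← det_antiBasis_gram_map]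
  refine (map_ne_zero_iff _ (RatFunc.algebraMap_injective ℚ)).mpr fun h => ?_
  have h0 := congrArg (Polynomial.evalRingHom (0 : ℚ)) h
  rw [det_antiBasis_gram_map, Polynomial.coe_evalRingHom, Polynomial.eval_X,
    Polynomial.eval_zero] at h0
  exact det_antiBasis_gram_zero_ne_zero h0

/-- The vertices of `treeGraph w m`, split into those of `𝖳` and those of the attached path. -/
def vertexSplit (m : ℕ) : Fin 16 ⊕ Fin m ≃ Fin (m + 16) :=
  finSumFinEquiv.trans (finCongr (Nat.add_comm 16 m))

section TreeGraph

variable {m : ℕ}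

@[simp] theorem vertexSplit_inl_val (i : Fin 16) : (vertexSplit m (Sum.inl i)).val = i.val := rfl

@[simp] theorem vertexSplit_inr_val (k : Fin m) :
    (vertexSplit m (Sum.inr k)).val = 16 + k.val := rfl

theorem le_of_mem_baseEdges {a b : ℕ} (h : (a, b) ∈ baseEdges) : a ≤ 16 ∧ b ≤ 16 ∧ a ≠ b := by
  have : ∀ p ∈ baseEdges, p.1 ≤ 16 ∧ p.2 ≤ 16 ∧ p.1 ≠ p.2 := by decide
  exact this _ h

theorem treeGraph_adj_inl_inl (a i j : Fin 16) :
    (treeGraph (a + 1) m).Adj (vertexSplit m (.inl i)) (vertexSplit m (.inl j)) ↔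
      baseAdj i j := by
  simp only [treeGraph, SimpleGraph.fromRel_adj, vertexSplit_inl_val, ne_eq, Fin.ext_iff, baseAdj]
  constructor
  · rintro ⟨-, (h | h | h) | (h | h | h)⟩
    all_goals first | exact .inl h | exact .inr h | omega
  · rintro (h | h)
    · exact ⟨by have := le_of_mem_baseEdges h; omega, .inl (.inl h)⟩
    · exact ⟨by have := le_of_mem_baseEdges h; omega, .inr (.inl h)⟩

theorem treeGraph_adj_inl_inr (a i : Fin 16) (k : Fin m) :
    (treeGraph (a + 1) m).Adj (vertexSplit m (.inl i)) (vertexSplit m (.inr k)) ↔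
      i = a ∧ k.val = 0 := by
  simp only [treeGraph, SimpleGraph.fromRel_adj, vertexSplit_inl_val, vertexSplit_inr_val, ne_eq,
    Fin.ext_iff]
  constructor
  · rintro ⟨-, (h | h | h) | (h | h | h)⟩
    all_goals first | omega | (have := le_of_mem_baseEdges h; omega)
  · rintro ⟨h, h'⟩
    exact ⟨by omega, .inl (.inr (.inl (by omega)))⟩

theorem treeGraph_adj_inr_inr (a : Fin 16) (k l : Fin m) :
    (treeGraph (a + 1) m).Adj (vertexSplit m (.inr k)) (vertexSplit m (.inr l)) ↔
      k.val + 1 = l.val ∨ l.val + 1 = k.val := by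
  simp only [treeGraph, SimpleGraph.fromRel_adj, vertexSplit_inr_val, ne_eq, Fin.ext_iff]
  constructor
  · rintro ⟨-, (h | h | h) | (h | h | h)⟩
    all_goals first | omega | (have := le_of_mem_baseEdges h; omega)
  · rintro (h | h)
    · exact ⟨by omega, .inl (.inr (.inr (by omega)))⟩
    · exact ⟨by omega, .inr (.inr (.inr (by omega)))⟩

theorem treeGraph_adj_inr_inl (a i : Fin 16) (k : Fin m) :
    (treeGraph (a + 1) m).Adj (vertexSplit m (.inr k)) (vertexSplit m (.inl i)) ↔
      i = a ∧ k.val = 0 := by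
  rw [SimpleGraph.adj_comm, treeGraph_adj_inl_inr]

variable {R : Type*} [CommRing R]

theorem treeGraph_degree_eq_sum (w : ℕ) (v : Fin (m + 16)) :
    ((treeGraph w m).degree v : R) =
      (∑ j, if (treeGraph w m).Adj v (vertexSplit m (.inl j)) then (1 : R) else 0) +
      ∑ k, if (treeGraph w m).Adj v (vertexSplit m (.inr k)) then (1 : R) else 0 := by
  rw [← Fintype.sum_sum_type
    (fun s => if (treeGraph w m).Adj v (vertexSplit m s) then (1 : R) else 0),
    (vertexSplit m).sum_comp (fun j => if (treeGraph w m).Adj v j then (1 : R) else 0),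
    SimpleGraph.degree_eq_sum_if_adj]

/-- The indicator of the first vertex of the attached path. -/
def pathStart (R : Type*) [CommRing R] (m : ℕ) (k : Fin m) : R := if k.val = 0 then 1 else 0

theorem treeGraph_degree_inl (a i : Fin 16) :
    ((treeGraph (a + 1) m).degree (vertexSplit m (.inl i)) : R) =
      (∑ j, if baseAdj i j then 1 else 0) + if i = a then ∑ k, pathStart R m k else 0 := by
  simp only [treeGraph_degree_eq_sum, treeGraph_adj_inl_inl, treeGraph_adj_inl_inr, pathStart]
  split_ifs with h <;> simp [h]

theorem treeGraph_degree_inr (a : Fin 16) (k : Fin m) :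
    ((treeGraph (a + 1) m).degree (vertexSplit m (.inr k)) : R) =
      pathStart R m k + ∑ l : Fin m, if k.val + 1 = l.val ∨ l.val + 1 = k.val then 1 else 0 := by
  simp only [treeGraph_degree_eq_sum, treeGraph_adj_inr_inl, treeGraph_adj_inr_inr, pathStart]
  congr 1
  split_ifs with h <;> simp [h]

end TreeGraph

open Polynomial in
/-- The diagonal block of `charLmu (treeGraph w m)` on the attached path. -/
noncomputable def pathBlock (m : ℕ) : Matrix (Fin m) (Fin m) (RatFunc ℚ)[X] :=
  (X : (RatFunc ℚ)[X]) • (1 : Matrix (Fin m) (Fin m) (RatFunc ℚ)[X]) -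
    (Matrix.of (fun k l => if k.val + 1 = l.val ∨ l.val + 1 = k.val then 1 else 0) -
      C (RatFunc.X : RatFunc ℚ) • Matrix.diagonal (fun k => pathStart _ m k +
        ∑ l : Fin m, if k.val + 1 = l.val ∨ l.val + 1 = k.val then 1 else 0))

open Polynomial Matrix in
theorem charLmu_treeGraph_submatrix (m : ℕ) (a : Fin 16) :
    (charLmu (treeGraph (a + 1) m)).submatrix (vertexSplit m) (vertexSplit m) =
      fromBlocks
        ((X : (RatFunc ℚ)[X]) • 1 - baseL (C (RatFunc.X : RatFunc ℚ)) +
          (C (RatFunc.X : RatFunc ℚ) * ∑ k, pathStart _ m k) • vecMulVec (Pi.single a 1) (Pi.single a 1))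
        (-vecMulVec (Pi.single a 1) (pathStart _ m))
        (-vecMulVec (pathStart _ m) (Pi.single a 1))
        (pathBlock m) := by
  ext1 s t
  rcases s with i | k <;> rcases t with j | l
  · simp only [charLmu, baseL, submatrix_apply, fromBlocks_apply₁₁, Matrix.sub_apply,
      Matrix.add_apply, Matrix.smul_apply, SimpleGraph.adjMatrix_apply, treeGraph_adj_inl_inl,
      diagonal_apply, one_apply, EmbeddingLike.apply_eq_iff_eq, Sum.inl.injEq, smul_eq_mul,
      treeGraph_degree_inl, vecMulVec_apply, Pi.single_apply, of_apply]
    split_ifs <;> first | ring1 | (exfalso; grind)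
  · simp [charLmu, treeGraph_adj_inl_inr, one_apply, vecMulVec_apply, Pi.single_apply, pathStart,
      ← ite_and, and_comm]
  · simp [charLmu, treeGraph_adj_inr_inl, one_apply, vecMulVec_apply, Pi.single_apply, pathStart,
      ← ite_and, and_comm]
  · simp only [charLmu, pathBlock, submatrix_apply, fromBlocks_apply₂₂, Matrix.sub_apply,
      Matrix.smul_apply, SimpleGraph.adjMatrix_apply, treeGraph_adj_inr_inr,
      diagonal_apply, one_apply, EmbeddingLike.apply_eq_iff_eq, Sum.inr.injEq, smul_eq_mul,
      treeGraph_degree_inr, of_apply]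

/-- For every `m ≥ 0`, the matrices `t I - L_μ(G₁)` and `t I - L_μ(G₂)` are equivalent
over `ℚ(μ)[t]` (equivalently, have the same Smith normal form over `ℚ(μ)[t]`), where
`G₁`, `G₂` are the trees obtained from `𝖳` by attaching the path `17–⋯–(16+m)` at
vertex `4`, resp. vertex `7`. -/
theorem stmt4 (m : ℕ) :
    ∃ U W : Matrix (Fin (m + 16)) (Fin (m + 16)) (Polynomial (RatFunc ℚ)),
      IsUnit U.det ∧ IsUnit W.det ∧
      U * charLmu (treeGraph 4 m) * W = charLmu (treeGraph 7 m) := by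
  obtain ⟨Q, hQQ, hQL, hQu, huQ⟩ :=
    exists_involution_single_eq_single isUnit_det_antiBasis_gram
  have hQB : Q *
      ((Polynomial.X : Polynomial (RatFunc ℚ)) • 1 - baseL (Polynomial.C RatFunc.X)) * Q =
      (Polynomial.X : Polynomial (RatFunc ℚ)) • 1 - baseL (Polynomial.C RatFunc.X) := by
    rw [Matrix.mul_assoc, Matrix.sub_mul, hQL.eq, Matrix.smul_mul, Matrix.one_mul,
      Matrix.mul_sub, Matrix.mul_smul, ← Matrix.mul_assoc, hQQ, Matrix.one_mul]
  refine Matrix.exists_isUnit_det_mul_mul_eq_of_submatrix (vertexSplit m)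
    (T := Matrix.fromBlocks Q 0 0 1) ?_ ?_
  · simp [Matrix.fromBlocks_multiply, hQQ]
  · have h4 := charLmu_treeGraph_submatrix m 3
    have h7 := charLmu_treeGraph_submatrix m 6
    rw [show ((3 : Fin 16) : ℕ) + 1 = 4 from rfl] at h4
    rw [show ((6 : Fin 16) : ℕ) + 1 = 7 from rfl] at h7
    rw [h4, h7]
    exact Matrix.fromBlocks_mul_fromBlocks_rankOne_mul_fromBlocks hQu huQ hQB _ _ _
end

section
/- Let G be a 1-walk regular graph on a finite vertex set V, and let H be a finite simple graph on a vertex set W. Let φ₁, φ₂ : W → V be injective maps such that the image of each φᵢ is a clique of G (any two distinct vertices in the image are adjacent in G). For i = 1, 2 let Gᵢ be the graph obtained from G by deleting the edges {φᵢ(u)φᵢ(v) : uv an edge of H}. Then G₁ and G₂ have the same μ-polynomial: for all real t and μ, det(tI − A(G₁) + μD(G₁)) = det(tI − A(G₂) + μD(G₂)). -/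
open scoped Classical

/-- A graph is 1-walk regular if, for every `k ≥ 0`, all diagonal entries of `A^k`
coincide, and all entries `(A^k)_{uv}` with `u, v` adjacent coincide. -/
noncomputable def OneWalkRegular {V : Type*} [Fintype V] [DecidableEq V]
    (G : SimpleGraph V) : Prop :=
  ∀ k : ℕ,
    (∀ u v : V, ((G.adjMatrix ℝ) ^ k) u u = ((G.adjMatrix ℝ) ^ k) v v) ∧
    (∀ u v u' v' : V, G.Adj u v → G.Adj u' v' →
      ((G.adjMatrix ℝ) ^ k) u v = ((G.adjMatrix ℝ) ^ k) u' v')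

section Incl

open Matrix

/-- The `0`-`1` matrix of a map `φ : W → V`, with a `1` in position `(φ w, w)`. -/
noncomputable def incl {V W : Type*} [DecidableEq V] (φ : W → V) : Matrix V W ℝ :=
  (1 : Matrix V V ℝ).submatrix id φ

variable {V W : Type*} [DecidableEq V]

lemma incl_transpose_mul_mul [Fintype V] (φ : W → V) (N : Matrix V V ℝ) :
    (incl φ)ᵀ * N * incl φ = N.submatrix φ φ := by
  ext i j
  simp [incl, Matrix.mul_apply, Matrix.one_apply]

lemma incl_transpose_mulVec_one [Fintype V] (φ : W → V) : (incl φ)ᵀ *ᵥ 1 = 1 := by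
  ext i
  simp [incl, Matrix.mulVec, dotProduct, Matrix.one_apply]

lemma incl_mulVec_apply [Fintype W] {φ : W → V} (hφ : Function.Injective φ) (f : W → ℝ) (a : W) :
    (incl φ *ᵥ f) (φ a) = f a := by
  simp [incl, Matrix.mulVec, dotProduct, Matrix.one_apply, hφ.eq_iff]

lemma incl_mulVec_of_notMem [Fintype W] {φ : W → V} (f : W → ℝ) {v : V} (hv : v ∉ Set.range φ) :
    (incl φ *ᵥ f) v = 0 := by
  have h : ∀ w, v ≠ φ w := fun w hw => hv ⟨w, hw.symm⟩
  simp [incl, Matrix.mulVec, dotProduct, h]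

lemma incl_mul_mul_apply [Fintype W] {φ : W → V} (hφ : Function.Injective φ) (M : Matrix W W ℝ)
    (a b : W) :
    (incl φ * M * (incl φ)ᵀ) (φ a) (φ b) = M a b := by
  simp [incl, Matrix.mul_apply, Matrix.one_apply, hφ.eq_iff]

lemma incl_mul_mul_of_notMem_left [Fintype W] {φ : W → V} (M : Matrix W W ℝ) {i : V} (j : V)
    (hi : i ∉ Set.range φ) : (incl φ * M * (incl φ)ᵀ) i j = 0 := by
  have h : ∀ w, i ≠ φ w := fun w hw => hi ⟨w, hw.symm⟩
  simp [incl, Matrix.mul_apply, Matrix.one_apply, h]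

lemma incl_mul_mul_of_notMem_right [Fintype W] {φ : W → V} (M : Matrix W W ℝ) (i : V) {j : V}
    (hj : j ∉ Set.range φ) : (incl φ * M * (incl φ)ᵀ) i j = 0 := by
  have h : ∀ w, φ w ≠ j := fun w hw => hj ⟨w, hw⟩
  simp [incl, Matrix.mul_apply, Matrix.one_apply, h]

lemma incl_mul_diagonal_mul [Fintype W] [DecidableEq W] {φ : W → V}
    (hφ : Function.Injective φ) (f : W → ℝ) :
    incl φ * diagonal f * (incl φ)ᵀ = diagonal (incl φ *ᵥ f) := by
  ext i j
  by_cases hi : i ∈ Set.range φ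
  · by_cases hj : j ∈ Set.range φ
    · obtain ⟨a, rfl⟩ := hi
      obtain ⟨b, rfl⟩ := hj
      simp [incl_mul_mul_apply hφ, diagonal_apply, incl_mulVec_apply hφ, hφ.eq_iff]
    · have hij : i ≠ j := by
        rintro rfl
        exact hj hi
      rw [incl_mul_mul_of_notMem_right _ _ hj, diagonal_apply_ne _ hij]
  · rw [incl_mul_mul_of_notMem_left _ _ hi, diagonal_apply, incl_mulVec_of_notMem f hi, ite_self]

end Incl

section Matrix

open Matrix Polynomial

variable {V W : Type*} [Fintype V] [DecidableEq V]

/-- The inverse of an invertible matrix is a polynomial in that matrix. -/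
lemma exists_aeval_eq_inv (X : Matrix V V ℝ) (hX : IsUnit X.det) :
    ∃ p : ℝ[X], aeval X p = X⁻¹ := by
  have hc : X.charpoly.coeff 0 ≠ 0 := by
    intro h
    apply hX.ne_zero
    rw [Matrix.det_eq_sign_charpoly_coeff, h, mul_zero]
  refine ⟨C (-(X.charpoly.coeff 0)⁻¹) * X.charpoly.divX, ?_⟩
  have h := Matrix.aeval_self_charpoly X
  rw [← Polynomial.X_mul_divX_add X.charpoly] at h
  simp only [map_add, map_mul, aeval_X, aeval_C] at h
  symm
  apply Matrix.inv_eq_right_inv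
  rw [map_mul, aeval_C, Algebra.algebraMap_eq_smul_one, smul_mul_assoc, one_mul, mul_smul_comm,
    eq_neg_of_add_eq_zero_left h, Algebra.algebraMap_eq_smul_one, smul_neg, smul_smul, neg_mul,
    inv_mul_cancel₀ hc]
  simp

lemma submatrix_aeval_eq {A : Matrix V V ℝ} {φ₁ φ₂ : W → V}
    (hA : ∀ k : ℕ, (A ^ k).submatrix φ₁ φ₁ = (A ^ k).submatrix φ₂ φ₂) (p : ℝ[X]) :
    (aeval A p).submatrix φ₁ φ₁ = (aeval A p).submatrix φ₂ φ₂ := by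
  induction p using Polynomial.induction_on' with
  | add p q hp hq => simp only [map_add, submatrix_add, Pi.add_apply, hp, hq]
  | monomial n a =>
    simp only [aeval_monomial, ← Algebra.smul_def, submatrix_smul, Pi.smul_apply, hA]

/-- If all powers of `A` have the same blocks along `φ₁` and `φ₂`, then perturbing `A` by the same
matrix `M` on either block gives the same characteristic polynomial. -/
lemma charpoly_sub_incl_eq [Fintype W] [DecidableEq W]
    {A : Matrix V V ℝ} {φ₁ φ₂ : W → V}
    (hA : ∀ k : ℕ, (A ^ k).submatrix φ₁ φ₁ = (A ^ k).submatrix φ₂ φ₂) (M : Matrix W W ℝ) :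
    (A - incl φ₁ * M * (incl φ₁)ᵀ).charpoly = (A - incl φ₂ * M * (incl φ₂)ᵀ).charpoly := by
  apply mul_left_cancel₀ (Matrix.charpoly_monic A).ne_zero
  refine Polynomial.funext fun s => ?_
  simp only [eval_mul, Matrix.eval_charpoly]
  by_cases hs : (scalar V s - A).det = 0
  · rw [hs, zero_mul, zero_mul]
  have hu : IsUnit (scalar V s - A).det := isUnit_iff_ne_zero.mpr hs
  obtain ⟨p, hp⟩ := exists_aeval_eq_inv _ hu
  have hcomp : (scalar V s - A)⁻¹ = aeval A (p.comp (C s - X)) := by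
    rw [← hp, aeval_comp]
    simp [Matrix.algebraMap_eq_diagonal, Pi.algebraMap_def]
  have key : ∀ φ : W → V, (scalar V s - (A - incl φ * M * (incl φ)ᵀ)).det =
      (scalar V s - A).det * (1 + (scalar V s - A)⁻¹.submatrix φ φ * M).det := by
    intro φ
    rw [← incl_transpose_mul_mul, sub_sub_eq_add_sub, add_sub_right_comm,
      Matrix.det_add_mul _ _ hu]
    simp only [Matrix.mul_assoc]
  rw [key, key, hcomp, submatrix_aeval_eq hA]

end Matrix

section Graph

open Matrix

variable {V W : Type*} [DecidableEq V]

lemma OneWalkRegular.exists_degree_eq [Fintype V] {G : SimpleGraph V} (hG : OneWalkRegular G) :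
    ∃ d : ℝ, ∀ v, (G.degree v : ℝ) = d := by
  rcases isEmpty_or_nonempty V with h | ⟨⟨v₀⟩⟩
  · exact ⟨0, fun v => h.elim v⟩
  refine ⟨G.degree v₀, fun v => ?_⟩
  have h := (hG 2).1 v v₀
  rw [pow_two, SimpleGraph.adjMatrix_mul_self_apply_self,
    SimpleGraph.adjMatrix_mul_self_apply_self] at h
  exact h

lemma OneWalkRegular.submatrix_pow_eq [Fintype V] {G : SimpleGraph V} (hG : OneWalkRegular G)
    {φ₁ φ₂ : W → V} (hφ₁ : Function.Injective φ₁) (hφ₂ : Function.Injective φ₂)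
    (hcl₁ : G.IsClique (Set.range φ₁)) (hcl₂ : G.IsClique (Set.range φ₂)) (k : ℕ) :
    (G.adjMatrix ℝ ^ k).submatrix φ₁ φ₁ = (G.adjMatrix ℝ ^ k).submatrix φ₂ φ₂ := by
  ext a b
  rcases eq_or_ne a b with rfl | hab
  · exact (hG k).1 _ _
  · exact (hG k).2 _ _ _ _ (hcl₁ ⟨a, rfl⟩ ⟨b, rfl⟩ (hφ₁.ne hab))
      (hcl₂ ⟨a, rfl⟩ ⟨b, rfl⟩ (hφ₂.ne hab))

lemma adjMatrix_deleteEdges_map [Fintype W]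
    {G G' : SimpleGraph V} {H : SimpleGraph W} {φ : W → V}
    (hφ : Function.Injective φ) (hcl : G.IsClique (Set.range φ))
    (hG' : G' = G.deleteEdges {e | ∃ u v : W, H.Adj u v ∧ e = s(φ u, φ v)}) :
    G'.adjMatrix ℝ = G.adjMatrix ℝ - incl φ * H.adjMatrix ℝ * (incl φ)ᵀ := by
  have hadj : ∀ i j, G'.Adj i j ↔
      G.Adj i j ∧ ¬ ∃ u v : W, H.Adj u v ∧ s(i, j) = s(φ u, φ v) := by
    intro i j
    rw [hG', SimpleGraph.deleteEdges_adj, Set.mem_ofPred_eq]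
  ext i j
  rw [Matrix.sub_apply, SimpleGraph.adjMatrix_apply, SimpleGraph.adjMatrix_apply]
  by_cases hij : i ∈ Set.range φ ∧ j ∈ Set.range φ
  · obtain ⟨⟨a, rfl⟩, ⟨b, rfl⟩⟩ := hij
    rw [incl_mul_mul_apply hφ, SimpleGraph.adjMatrix_apply]
    have h1 : (∃ u v : W, H.Adj u v ∧ s(φ a, φ b) = s(φ u, φ v)) ↔ H.Adj a b := by
      constructor
      · rintro ⟨u, v, huv, h⟩
        rcases Sym2.eq_iff.mp h with ⟨h₁, h₂⟩ | ⟨h₁, h₂⟩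
        · rwa [hφ h₁, hφ h₂]
        · rw [hφ h₁, hφ h₂]
          exact huv.symm
      · exact fun h => ⟨a, b, h, rfl⟩
    have h2 : H.Adj a b → G.Adj (φ a) (φ b) := fun h => hcl ⟨a, rfl⟩ ⟨b, rfl⟩ (hφ.ne h.ne)
    simp only [hadj, h1]
    by_cases h : H.Adj a b
    · simp [h, h2 h]
    · simp [h]
  · have h0 : (incl φ * H.adjMatrix ℝ * (incl φ)ᵀ) i j = 0 := by
      rcases not_and_or.mp hij with h | h
      · exact incl_mul_mul_of_notMem_left _ _ h
      · exact incl_mul_mul_of_notMem_right _ _ h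
    have h1 : ¬ ∃ u v : W, H.Adj u v ∧ s(i, j) = s(φ u, φ v) := by
      rintro ⟨u, v, -, h⟩
      rcases Sym2.eq_iff.mp h with ⟨rfl, rfl⟩ | ⟨rfl, rfl⟩ <;> exact hij ⟨⟨_, rfl⟩, ⟨_, rfl⟩⟩
    simp only [hadj, h0, h1, not_false_eq_true, and_true, sub_zero]

lemma adjMatrix_mulVec_one {U : Type*} [Fintype U] (G : SimpleGraph U) :
    G.adjMatrix ℝ *ᵥ 1 = fun v => (G.degree v : ℝ) := by
  ext v
  simp [SimpleGraph.adjMatrix_mulVec_apply]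

lemma degMatrix_eq [Fintype V] (G : SimpleGraph V) : degMatrix G = diagonal (G.adjMatrix ℝ *ᵥ 1) := by
  rw [adjMatrix_mulVec_one, degMatrix]

lemma degMatrix_deleteEdges_map [Fintype V] [Fintype W] [DecidableEq W]
    {G G' : SimpleGraph V} {H : SimpleGraph W} {φ : W → V}
    (hφ : Function.Injective φ) (hcl : G.IsClique (Set.range φ))
    (hG' : G' = G.deleteEdges {e | ∃ u v : W, H.Adj u v ∧ e = s(φ u, φ v)}) :
    degMatrix G' = degMatrix G - incl φ * degMatrix H * (incl φ)ᵀ := by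
  rw [degMatrix_eq, degMatrix_eq, degMatrix_eq, adjMatrix_deleteEdges_map hφ hcl hG',
    incl_mul_diagonal_mul hφ, diagonal_sub, sub_mulVec, ← mulVec_mulVec, ← mulVec_mulVec,
    incl_transpose_mulVec_one]
  rfl

/-- For `G` regular of degree `d`, the `μ`-polynomial of `G` with a copy of `H` deleted from a
clique is a value of the characteristic polynomial of a perturbation of the adjacency matrix. -/
lemma det_deleteEdges_map [Fintype V] [Fintype W] [DecidableEq W]
    {G G' : SimpleGraph V} {H : SimpleGraph W} {φ : W → V}
    (hφ : Function.Injective φ) (hcl : G.IsClique (Set.range φ))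
    (hG' : G' = G.deleteEdges {e | ∃ u v : W, H.Adj u v ∧ e = s(φ u, φ v)})
    {d : ℝ} (hd : ∀ v, (G.degree v : ℝ) = d) (t μ : ℝ) :
    (t • (1 : Matrix V V ℝ) - G'.adjMatrix ℝ + μ • degMatrix G').det =
      (G.adjMatrix ℝ - incl φ * (H.adjMatrix ℝ - μ • degMatrix H) * (incl φ)ᵀ).charpoly.eval
        (t + μ * d) := by
  have hD : degMatrix G = d • (1 : Matrix V V ℝ) := by
    rw [degMatrix, smul_one_eq_diagonal]
    simp only [hd]
  have hs : scalar V (t + μ * d) = (t + μ * d) • (1 : Matrix V V ℝ) := by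
    rw [smul_one_eq_diagonal, scalar_apply]
  rw [Matrix.eval_charpoly, adjMatrix_deleteEdges_map hφ hcl hG',
    degMatrix_deleteEdges_map hφ hcl hG', hD, hs, Matrix.mul_sub, Matrix.sub_mul, Matrix.mul_smul,
    Matrix.smul_mul]
  congr 1
  module

end Graph

theorem stmt7 {V W : Type*} [Fintype V] [DecidableEq V] [Fintype W] [DecidableEq W]
    (G : SimpleGraph V) (H : SimpleGraph W)
    (hG : OneWalkRegular G)
    (φ₁ φ₂ : W → V)
    (hφ₁ : Function.Injective φ₁) (hφ₂ : Function.Injective φ₂)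
    (hcl₁ : G.IsClique (Set.range φ₁)) (hcl₂ : G.IsClique (Set.range φ₂))
    (G₁ G₂ : SimpleGraph V)
    (hG₁ : G₁ = G.deleteEdges {e | ∃ u v : W, H.Adj u v ∧ e = s(φ₁ u, φ₁ v)})
    (hG₂ : G₂ = G.deleteEdges {e | ∃ u v : W, H.Adj u v ∧ e = s(φ₂ u, φ₂ v)}) :
    ∀ t μ : ℝ,
      (t • (1 : Matrix V V ℝ) - G₁.adjMatrix ℝ + μ • degMatrix G₁).det =
      (t • (1 : Matrix V V ℝ) - G₂.adjMatrix ℝ + μ • degMatrix G₂).det := by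
  intro t μ
  obtain ⟨d, hd⟩ := hG.exists_degree_eq
  rw [det_deleteEdges_map hφ₁ hcl₁ hG₁ hd, det_deleteEdges_map hφ₂ hcl₂ hG₂ hd,
    charpoly_sub_incl_eq (hG.submatrix_pow_eq hφ₁ hφ₂ hcl₁ hcl₂)]
end

section
/- Let G be a strongly regular graph with parameters (n,d;a,c) on a finite vertex set V, and let H be a finite simple graph on a vertex set W. Let φ₁, φ₂ : W → V be injective maps such that the image of each φᵢ is a clique of G. For i = 1, 2 let Gᵢ be the graph obtained from G by deleting the edges {φᵢ(u)φᵢ(v) : uv an edge of H}. Then G₁ and G₂ have the same μ-polynomial (for all real t and μ, det(tI − A(G₁) + μD(G₁)) = det(tI − A(G₂) + μD(G₂))), and the complements G₁ᶜ and G₂ᶜ also have the same μ-polynomial. -/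
open scoped Classical

namespace Matrix

variable {V W : Type*} [DecidableEq V]

/-- A unital subalgebra of a matrix algebra over a field is closed under inverses. -/
theorem inv_mem_subalgebra [Fintype V] {K : Type*} [Field K] (S : Subalgebra K (Matrix V V K))
    {M : Matrix V V K} (hM : M ∈ S) (h : IsUnit M.det) : M⁻¹ ∈ S := by
  have hinj : Function.Injective (LinearMap.mulLeft K (⟨M, hM⟩ : S)) := by
    intro x y hxy
    have hxy' : M * (x : Matrix V V K) = M * y := congrArg Subtype.val hxy
    apply Subtype.ext
    rw [← nonsing_inv_mul_cancel_left M (x : Matrix V V K) h, hxy',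
      nonsing_inv_mul_cancel_left M (y : Matrix V V K) h]
  obtain ⟨x, hx⟩ := LinearMap.injective_iff_surjective.mp hinj 1
  have hx' : M * (x : Matrix V V K) = 1 := congrArg Subtype.val hx
  rw [inv_eq_right_inv hx']
  exact x.2

/-- Two low-rank perturbations of a matrix `M` have the same determinant if the two embeddings
compress every element of a subalgebra containing `M` to the same matrix. -/
theorem det_add_mul_mul_transpose_eq [Fintype V] [Fintype W] [DecidableEq W] {K : Type*} [Field K] [Infinite K]
    (S : Subalgebra K (Matrix V V K)) (P₁ P₂ : Matrix V W K)
    (hS : ∀ X ∈ S, P₁ᵀ * X * P₁ = P₂ᵀ * X * P₂) {M : Matrix V V K} (hM : M ∈ S)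
    (N : Matrix W W K) :
    (M + P₁ * N * P₁ᵀ).det = (M + P₂ * N * P₂ᵀ).det := by
  have eval_neg (X : Matrix V V K) (t : K) :
      (-X).charpoly.eval t = (algebraMap K _ t + X).det := by
    rw [eval_charpoly, sub_neg_eq_add]
    rfl
  have hpoly : (-(M + P₁ * N * P₁ᵀ)).charpoly = (-(M + P₂ * N * P₂ᵀ)).charpoly := by
    apply Polynomial.eq_of_infinite_eval_eq
    have hfin : {t : K | (-M).charpoly.IsRoot t}.Finite :=
      Polynomial.finite_setOfPred_isRoot (charpoly_monic _).ne_zero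
    refine hfin.infinite_compl.mono fun t ht => ?_
    have hu : IsUnit (algebraMap K _ t + M).det := by
      rw [← eval_neg]
      exact isUnit_iff_ne_zero.mpr ht
    have hinv := inv_mem_subalgebra S (S.add_mem (S.algebraMap_mem t) hM) hu
    have hdet (P : Matrix V W K) : (algebraMap K _ t + M + P * N * Pᵀ).det =
        (algebraMap K _ t + M).det * (1 + Pᵀ * (algebraMap K _ t + M)⁻¹ * P * N).det := by
      rw [det_add_mul _ _ hu, Matrix.mul_assoc _ P N]
    simp only [Set.mem_ofPred_eq]
    rw [eval_neg, eval_neg, ← add_assoc, ← add_assoc, hdet, hdet, hS _ hinv]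
  have h := congrArg (Polynomial.eval 0) hpoly
  rwa [eval_neg, eval_neg, map_zero, zero_add, zero_add] at h

/-- The `0`-`1` matrix whose column `w` is the indicator of `φ w`. -/
def embeddingMatrix (φ : W → V) : Matrix V W ℝ :=
  (1 : Matrix V V ℝ).submatrix id φ

theorem embeddingMatrix_transpose_mul_mul [Fintype V] (φ : W → V) (X : Matrix V V ℝ) :
    (embeddingMatrix φ)ᵀ * X * embeddingMatrix φ = X.submatrix φ φ := by
  ext u v
  simp [embeddingMatrix, mul_apply, one_apply]

theorem embeddingMatrix_mul_mul_transpose_apply [Fintype W] (φ : W → V) (N : Matrix W W ℝ)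
    (x y : V) : (embeddingMatrix φ * N * (embeddingMatrix φ)ᵀ) x y =
      ∑ v, ∑ u, if x = φ u ∧ y = φ v then N u v else 0 := by
  simp only [embeddingMatrix, mul_apply, one_apply, submatrix_apply, transpose_apply, id,
    Finset.sum_mul]
  refine Finset.sum_congr rfl fun v _ => Finset.sum_congr rfl fun u _ => ?_
  split_ifs <;> simp_all

end Matrix

namespace SimpleGraph

open scoped Matrix

variable {V W : Type*} [DecidableEq V]

theorem adjMatrix_compl_eq (G : SimpleGraph V) [DecidableRel G.Adj] [DecidableRel Gᶜ.Adj] :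
    Gᶜ.adjMatrix ℝ = Matrix.of (fun _ _ => 1) - 1 - G.adjMatrix ℝ := by
  ext v w
  by_cases h : v = w
  · subst h; simp
  · by_cases h' : G.Adj v w <;> simp [adjMatrix_apply, h, h']

theorem adjMatrix_deleteEdges_image [Fintype W] {G G' : SimpleGraph V} (H : SimpleGraph W)
    [DecidableRel G.Adj] [DecidableRel G'.Adj] [DecidableRel H.Adj] {φ : W → V}
    (hφ : Function.Injective φ) (hcl : G.IsClique (Set.range φ))
    (hG' : G' = G.deleteEdges {e | ∃ u v : W, H.Adj u v ∧ e = s(φ u, φ v)}) :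
    G'.adjMatrix ℝ = G.adjMatrix ℝ -
      Matrix.embeddingMatrix φ * H.adjMatrix ℝ * (Matrix.embeddingMatrix φ)ᵀ := by
  have hadj' (x y : V) : G'.Adj x y ↔
      G.Adj x y ∧ ¬ ∃ u v : W, H.Adj u v ∧ s(x, y) = s(φ u, φ v) := by
    rw [hG', deleteEdges_adj]
    rfl
  ext x y
  rw [Matrix.sub_apply, Matrix.embeddingMatrix_mul_mul_transpose_apply]
  by_cases h : ∃ u v, H.Adj u v ∧ s(x, y) = s(φ u, φ v)
  · have hsym : ∃ u v, H.Adj u v ∧ x = φ u ∧ y = φ v := by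
      obtain ⟨u, v, huv, he⟩ := h
      rcases Sym2.eq_iff.mp he with ⟨hx, hy⟩ | ⟨hx, hy⟩
      exacts [⟨u, v, huv, hx, hy⟩, ⟨v, u, huv.symm, hx, hy⟩]
    obtain ⟨u, v, huv, rfl, rfl⟩ := hsym
    have hadj : G.Adj (φ u) (φ v) :=
      hcl (Set.mem_range_self u) (Set.mem_range_self v) (hφ.ne huv.ne)
    simp only [adjMatrix_apply, hadj', h, hadj, hφ.eq_iff]
    simp [ite_and, huv]
  · have hzero : ∑ v, ∑ u, (if x = φ u ∧ y = φ v then H.adjMatrix ℝ u v else 0) = 0 := by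
      refine Finset.sum_eq_zero fun v _ => Finset.sum_eq_zero fun u _ => ?_
      split_ifs with huv
      · have hn : ¬ H.Adj u v := fun h' => h ⟨u, v, h', by rw [huv.1, huv.2]⟩
        simp [hn]
      · rfl
    rw [hzero, sub_zero]
    simp only [adjMatrix_apply, hadj', h, not_false_eq_true, and_true]

variable [Fintype V]

theorem degMatrix_eq_diagonal_sum (G : SimpleGraph V) [DecidableRel G.Adj] :
    _root_.degMatrix G = Matrix.diagonal fun v => ∑ w, G.adjMatrix ℝ v w := by
  unfold _root_.degMatrix
  congr 1
  ext v
  simp [adjMatrix_apply, Finset.sum_boole, ← card_neighborFinset_eq_degree,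
    neighborFinset_eq_filter]
  congr!

theorem degMatrix_compl (G : SimpleGraph V) :
    _root_.degMatrix Gᶜ = ((Fintype.card V : ℝ) - 1) • 1 - _root_.degMatrix G := by
  rw [degMatrix_eq_diagonal_sum, degMatrix_eq_diagonal_sum, Matrix.smul_one_eq_diagonal,
    Matrix.diagonal_sub]
  congr 1
  ext v
  rw [adjMatrix_compl_eq G]
  simp [Finset.sum_sub_distrib, Matrix.one_apply]

theorem degMatrix_of_isRegular {G : SimpleGraph V} {d : ℕ} (h : G.IsRegularOfDegree d) :
    _root_.degMatrix G = (d : ℝ) • 1 := by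
  rw [Matrix.smul_one_eq_diagonal]
  unfold _root_.degMatrix
  congr 1
  ext v
  exact_mod_cast h v

/-- The adjacency algebra of a strongly regular graph, spanned by the identity, the adjacency
matrix and the all-ones matrix. -/
noncomputable def IsSRGWith.adjacencyAlgebra {G : SimpleGraph V} {n d a c : ℕ}
    (hG : G.IsSRGWith n d a c) : Subalgebra ℝ (Matrix V V ℝ) where
  carrier := {X | ∃ α β γ : ℝ,
    X = α • 1 + β • G.adjMatrix ℝ + γ • Matrix.of fun _ _ => 1}
  add_mem' := by
    rintro _ _ ⟨α, β, γ, rfl⟩ ⟨α', β', γ', rfl⟩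
    exact ⟨α + α', β + β', γ + γ', by module⟩
  algebraMap_mem' r := ⟨r, 0, 0, by simp [Algebra.algebraMap_eq_smul_one]⟩
  mul_mem' := by
    rintro _ _ ⟨α, β, γ, rfl⟩ ⟨α', β', γ', rfl⟩
    have hAA : G.adjMatrix ℝ * G.adjMatrix ℝ = ((d : ℝ) - c) • 1 +
        ((a : ℝ) - c) • G.adjMatrix ℝ + (c : ℝ) • Matrix.of fun _ _ => 1 := by
      rw [← sq, hG.matrix_eq (α := ℝ)]
      rw [adjMatrix_compl_eq G]
      simp only [← Nat.cast_smul_eq_nsmul ℝ]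
      module
    have hAJ : G.adjMatrix ℝ * Matrix.of (fun _ _ => 1) =
        (d : ℝ) • Matrix.of fun _ _ => 1 := by
      ext v w
      simp [adjMatrix_mul_apply, hG.regular v]
    have hJA : Matrix.of (fun _ _ => 1) * G.adjMatrix ℝ =
        (d : ℝ) • Matrix.of fun _ _ => 1 := by
      ext v w
      simp [mul_adjMatrix_apply, hG.regular w]
    have hJJ : (Matrix.of (fun _ _ => 1) : Matrix V V ℝ) * Matrix.of (fun _ _ => 1) =
        (Fintype.card V : ℝ) • Matrix.of fun _ _ => 1 := by
      ext v w
      simp [Matrix.mul_apply]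
    refine ⟨α * α' + β * β' * (d - c), α * β' + β * α' + β * β' * (a - c),
      α * γ' + γ * α' + γ * γ' * Fintype.card V + (β * γ' + γ * β') * d + β * β' * c, ?_⟩
    simp only [add_mul, mul_add, smul_mul_assoc, mul_smul_comm, one_mul, mul_one, hAA, hAJ, hJA,
      hJJ]
    module

theorem IsSRGWith.submatrix_eq {G : SimpleGraph V} {n d a c : ℕ} (hG : G.IsSRGWith n d a c)
    {φ₁ φ₂ : W → V} (hφ₁ : Function.Injective φ₁) (hφ₂ : Function.Injective φ₂)
    (hcl₁ : G.IsClique (Set.range φ₁)) (hcl₂ : G.IsClique (Set.range φ₂))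
    {X : Matrix V V ℝ} (hX : X ∈ hG.adjacencyAlgebra) :
    X.submatrix φ₁ φ₁ = X.submatrix φ₂ φ₂ := by
  obtain ⟨α, β, γ, rfl⟩ := hX
  ext u v
  by_cases h : u = v
  · subst h; simp
  · have h₁ : G.Adj (φ₁ u) (φ₁ v) :=
      hcl₁ (Set.mem_range_self u) (Set.mem_range_self v) (hφ₁.ne h)
    have h₂ : G.Adj (φ₂ u) (φ₂ v) :=
      hcl₂ (Set.mem_range_self u) (Set.mem_range_self v) (hφ₂.ne h)
    simp [hφ₁.ne h, hφ₂.ne h, h₁, h₂]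

variable [Fintype W] [DecidableEq W]

theorem diagonal_sum_embeddingMatrix (N : Matrix W W ℝ) (φ : W → V) :
    (Matrix.diagonal fun x =>
      ∑ y, (Matrix.embeddingMatrix φ * N * (Matrix.embeddingMatrix φ)ᵀ) x y) =
    Matrix.embeddingMatrix φ * (Matrix.diagonal fun u => ∑ v, N u v) *
      (Matrix.embeddingMatrix φ)ᵀ := by
  ext x y
  rw [Matrix.embeddingMatrix_mul_mul_transpose_apply, Matrix.diagonal_apply]
  simp only [Matrix.embeddingMatrix_mul_mul_transpose_apply, Matrix.diagonal_apply]
  have hr : ∀ v u : W, (if x = φ u ∧ y = φ v then (if u = v then ∑ w, N u w else 0) else 0) =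
      if u = v then (if x = φ u ∧ y = φ u then ∑ w, N u w else 0) else 0 := by
    intro v u
    by_cases h : u = v
    · subst h; simp
    · simp [h]
  simp only [hr, Finset.sum_ite_eq', Finset.mem_univ, if_true]
  split_ifs with h
  · subst h
    simp only [and_self]
    rw [Finset.sum_comm]
    have : ∀ v : W, (∑ y, ∑ u, if x = φ u ∧ y = φ v then N u v else 0) =
        ∑ u, if x = φ u then N u v else 0 := by
      intro v
      rw [Finset.sum_comm]
      simp [ite_and]
    simp only [this]
    rw [Finset.sum_comm]
    refine Finset.sum_congr rfl fun u _ => ?_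
    split_ifs <;> simp
  · symm
    refine Finset.sum_eq_zero fun u _ => if_neg ?_
    rintro ⟨rfl, rfl⟩
    exact h rfl

theorem degMatrix_deleteEdges_image {G G' : SimpleGraph V} (H : SimpleGraph W) {φ : W → V}
    (hφ : Function.Injective φ) (hcl : G.IsClique (Set.range φ))
    (hG' : G' = G.deleteEdges {e | ∃ u v : W, H.Adj u v ∧ e = s(φ u, φ v)}) :
    _root_.degMatrix G' = _root_.degMatrix G -
      Matrix.embeddingMatrix φ * _root_.degMatrix H * (Matrix.embeddingMatrix φ)ᵀ := by
  rw [degMatrix_eq_diagonal_sum G', degMatrix_eq_diagonal_sum G, degMatrix_eq_diagonal_sum H,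
    ← diagonal_sum_embeddingMatrix, Matrix.diagonal_sub, adjMatrix_deleteEdges_image H hφ hcl hG']
  simp only [Matrix.sub_apply, Finset.sum_sub_distrib]

theorem muMatrix_deleteEdges_image {G G' : SimpleGraph V} {d : ℕ} (hd : G.IsRegularOfDegree d)
    (H : SimpleGraph W) {φ : W → V} (hφ : Function.Injective φ)
    (hcl : G.IsClique (Set.range φ))
    (hG' : G' = G.deleteEdges {e | ∃ u v : W, H.Adj u v ∧ e = s(φ u, φ v)}) (t μ : ℝ) :
    t • (1 : Matrix V V ℝ) - G'.adjMatrix ℝ + μ • _root_.degMatrix G' =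
      ((t + μ * d) • 1 + (-1 : ℝ) • G.adjMatrix ℝ + (0 : ℝ) • Matrix.of fun _ _ => 1) +
        Matrix.embeddingMatrix φ * (H.adjMatrix ℝ - μ • _root_.degMatrix H) *
          (Matrix.embeddingMatrix φ)ᵀ := by
  rw [adjMatrix_deleteEdges_image H hφ hcl hG', degMatrix_deleteEdges_image H hφ hcl hG',
    degMatrix_of_isRegular hd, Matrix.mul_sub, Matrix.sub_mul, Matrix.mul_smul, Matrix.smul_mul]
  module

theorem muMatrix_compl_deleteEdges_image {G G' : SimpleGraph V} {d : ℕ}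
    (hd : G.IsRegularOfDegree d) (H : SimpleGraph W) {φ : W → V} (hφ : Function.Injective φ)
    (hcl : G.IsClique (Set.range φ))
    (hG' : G' = G.deleteEdges {e | ∃ u v : W, H.Adj u v ∧ e = s(φ u, φ v)}) (t μ : ℝ)
    [DecidableRel G'ᶜ.Adj] :
    t • (1 : Matrix V V ℝ) - G'ᶜ.adjMatrix ℝ + μ • _root_.degMatrix G'ᶜ =
      ((t + 1 + μ * (Fintype.card V - 1 - d)) • 1 + (1 : ℝ) • G.adjMatrix ℝ +
        (-1 : ℝ) • Matrix.of fun _ _ => 1) +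
        Matrix.embeddingMatrix φ * (μ • _root_.degMatrix H - H.adjMatrix ℝ) *
          (Matrix.embeddingMatrix φ)ᵀ := by
  rw [adjMatrix_compl_eq G', degMatrix_compl, adjMatrix_deleteEdges_image H hφ hcl hG',
    degMatrix_deleteEdges_image H hφ hcl hG', degMatrix_of_isRegular hd, Matrix.mul_sub,
    Matrix.sub_mul, Matrix.mul_smul, Matrix.smul_mul]
  module

end SimpleGraph

theorem stmt8 {V W : Type*} [Fintype V] [DecidableEq V] [Fintype W] [DecidableEq W]
    (G : SimpleGraph V) (n d a c : ℕ)
    (hG : G.IsSRGWith n d a c)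
    (H : SimpleGraph W)
    (φ₁ φ₂ : W → V)
    (hφ₁ : Function.Injective φ₁) (hφ₂ : Function.Injective φ₂)
    (hcl₁ : G.IsClique (Set.range φ₁)) (hcl₂ : G.IsClique (Set.range φ₂))
    (G₁ G₂ : SimpleGraph V)
    (hG₁ : G₁ = G.deleteEdges {e | ∃ u v : W, H.Adj u v ∧ e = s(φ₁ u, φ₁ v)})
    (hG₂ : G₂ = G.deleteEdges {e | ∃ u v : W, H.Adj u v ∧ e = s(φ₂ u, φ₂ v)}) :
    (∀ t μ : ℝ,
      (t • (1 : Matrix V V ℝ) - G₁.adjMatrix ℝ + μ • degMatrix G₁).det =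
      (t • (1 : Matrix V V ℝ) - G₂.adjMatrix ℝ + μ • degMatrix G₂).det) ∧
    (∀ t μ : ℝ,
      (t • (1 : Matrix V V ℝ) - (G₁ᶜ).adjMatrix ℝ + μ • degMatrix (G₁ᶜ)).det =
      (t • (1 : Matrix V V ℝ) - (G₂ᶜ).adjMatrix ℝ + μ • degMatrix (G₂ᶜ)).det) := by
  have hS : ∀ X ∈ hG.adjacencyAlgebra,
      (Matrix.embeddingMatrix φ₁).transpose * X * Matrix.embeddingMatrix φ₁ =
        (Matrix.embeddingMatrix φ₂).transpose * X * Matrix.embeddingMatrix φ₂ := by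
    intro X hX
    simp only [Matrix.embeddingMatrix_transpose_mul_mul]
    exact hG.submatrix_eq hφ₁ hφ₂ hcl₁ hcl₂ hX
  have key (α β γ : ℝ) (N : Matrix W W ℝ) :=
    Matrix.det_add_mul_mul_transpose_eq hG.adjacencyAlgebra _ _ hS
      (M := α • 1 + β • G.adjMatrix ℝ + γ • Matrix.of fun _ _ => 1) ⟨α, β, γ, rfl⟩ N
  constructor <;> intro t μ
  · rw [SimpleGraph.muMatrix_deleteEdges_image hG.regular H hφ₁ hcl₁ hG₁,
      SimpleGraph.muMatrix_deleteEdges_image hG.regular H hφ₂ hcl₂ hG₂]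
    exact key _ _ _ _
  · rw [SimpleGraph.muMatrix_compl_deleteEdges_image hG.regular H hφ₁ hcl₁ hG₁,
      SimpleGraph.muMatrix_compl_deleteEdges_image hG.regular H hφ₂ hcl₂ hG₂]
    exact key _ _ _ _
end

section
/- Let G be a strongly regular graph with parameters (n,d;a,c), and let e and f be any two edges of G. Then the graphs G∖e and G∖f obtained from G by deleting the edge e, respectively f, have the same μ-polynomial: for all real t and μ, det(tI − A(G∖e) + μD(G∖e)) = det(tI − A(G∖f) + μD(G∖f)). -/
open scoped Classical

open Matrix

/-- The inverse of an invertible matrix lies in every subspace containing `1` that is stable under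
left multiplication by the matrix. -/
theorem Matrix.inv_mem_submodule_of_mul_mem {V K : Type*} [Fintype V] [DecidableEq V] [Field K]
    (W : Submodule K (Matrix V V K)) (h_one : 1 ∈ W) {M : Matrix V V K} (hM : IsUnit M.det)
    (h_mul : ∀ X ∈ W, M * X ∈ W) : M⁻¹ ∈ W := by
  let φ : W →ₗ[K] W := (LinearMap.mulLeft K M).restrict h_mul
  have h_inj : Function.Injective φ := by
    intro X Y hXY
    have h : M * (X : Matrix V V K) = M * Y := congrArg Subtype.val hXY
    apply Subtype.ext
    rw [← nonsing_inv_mul_cancel_left M X.1 hM, h, nonsing_inv_mul_cancel_left M _ hM]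
  obtain ⟨X, hX⟩ := LinearMap.injective_iff_surjective.1 h_inj ⟨1, h_one⟩
  have h : M * (X : Matrix V V K) = 1 := congrArg Subtype.val hX
  rw [inv_eq_right_inv h]
  exact X.2

namespace SimpleGraph

variable {V : Type*} {G : SimpleGraph V} {n d a c : ℕ}

theorem IsSRGWith.adjMatrix_mul_self_eq [Fintype V] [DecidableEq V] (hG : G.IsSRGWith n d a c) :
    G.adjMatrix ℝ * G.adjMatrix ℝ =
      ((d : ℝ) - c) • (1 : Matrix V V ℝ) + ((a : ℝ) - c) • G.adjMatrix ℝ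
        + (c : ℝ) • (of 1 : Matrix V V ℝ) := by
  have h := hG.matrix_eq (α := ℝ)
  rw [sq] at h
  rw [h]
  ext i j
  simp only [Matrix.add_apply, Matrix.smul_apply, adjMatrix_apply, compl_adj, of_apply,
    Pi.one_apply, ← Nat.cast_smul_eq_nsmul ℝ, smul_eq_mul]
  obtain rfl | hij := eq_or_ne i j
  · simp
  · by_cases hA : G.Adj i j <;> simp [hij, hA]

theorem IsRegularOfDegree.adjMatrix_mul_of_one [Fintype V] (hG : G.IsRegularOfDegree d) :
    G.adjMatrix ℝ * (of 1 : Matrix V V ℝ) = (d : ℝ) • (of 1 : Matrix V V ℝ) := by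
  ext i j
  simp [hG.degree_eq]

/-- A matrix `s I - A` that is invertible, where `A` is the adjacency matrix of a strongly regular
graph, has its inverse in the Bose-Mesner algebra of the graph. -/
theorem IsSRGWith.exists_inv_smul_one_sub_adjMatrix_eq [Fintype V] [DecidableEq V] (hG : G.IsSRGWith n d a c) (s : ℝ)
    (hs : IsUnit (s • (1 : Matrix V V ℝ) - G.adjMatrix ℝ).det) :
    ∃ x y z : ℝ, x • (1 : Matrix V V ℝ) + y • G.adjMatrix ℝ + z • (of 1 : Matrix V V ℝ) =
      (s • (1 : Matrix V V ℝ) - G.adjMatrix ℝ)⁻¹ := by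
  rw [← Submodule.mem_span_triple]
  refine inv_mem_submodule_of_mul_mem _ (Submodule.subset_span (by simp)) hs fun X hX => ?_
  obtain ⟨x, y, z, rfl⟩ := Submodule.mem_span_triple.1 hX
  refine Submodule.mem_span_triple.2
    ⟨s * x - y * (d - c), s * y - x - y * (a - c), s * z - y * c - z * d, ?_⟩
  simp only [sub_mul, mul_add, smul_mul_assoc, one_mul, mul_smul_comm, mul_one,
    hG.adjMatrix_mul_self_eq, hG.regular.adjMatrix_mul_of_one]
  module

theorem adjMatrix_deleteEdges_pair_apply [DecidableEq V] {u v : V} (huv : G.Adj u v) (i j : V) :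
    (G.deleteEdges {s(u, v)}).adjMatrix ℝ i j = G.adjMatrix ℝ i j
      - ((if i = u then 1 else 0) * (if j = v then 1 else 0)
        + (if i = v then 1 else 0) * (if j = u then 1 else 0)) := by
  have hne := huv.ne
  have hvu := huv.symm
  simp only [adjMatrix_apply, deleteEdges_adj, Set.mem_singleton_iff, Sym2.eq_iff]
  split_ifs <;> grind

theorem degree_deleteEdges_pair [Fintype V] [DecidableEq V] {u v : V} (huv : G.Adj u v) (i : V)
    [Fintype ((G.deleteEdges {s(u, v)}).neighborSet i)] :
    ((G.deleteEdges {s(u, v)}).degree i : ℝ) = G.degree i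
      - ((if i = u then 1 else 0) + (if i = v then 1 else 0)) := by
  have h_deg (H : SimpleGraph V) [DecidableRel H.Adj] [Fintype (H.neighborSet i)] :
      (H.degree i : ℝ) = ∑ j, if H.Adj i j then 1 else 0 := by
    rw [← degree_eq_sum_if_adj]
    congr!
  rw [h_deg, h_deg]
  have h := fun j => adjMatrix_deleteEdges_pair_apply huv i j
  simp only [adjMatrix_apply] at h
  simp only [h, Finset.sum_sub_distrib, Finset.sum_add_distrib, ← Finset.mul_sum,
    Finset.sum_ite_eq', Finset.mem_univ, if_true, mul_one]

/-- The matrix whose columns are the indicator vectors of `u` and `v`. -/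
def pairIndicator [DecidableEq V] (u v : V) : Matrix V (Fin 2) ℝ :=
  of fun i => ![if i = u then 1 else 0, if i = v then 1 else 0]

theorem transpose_pairIndicator_mul_mul [Fintype V] [DecidableEq V] (M : Matrix V V ℝ) (u v : V) :
    (pairIndicator u v)ᵀ * M * pairIndicator u v = !![M u u, M u v; M v u, M v v] := by
  ext k l
  fin_cases k <;> fin_cases l <;> simp [pairIndicator, Matrix.mul_apply]

theorem IsRegularOfDegree.smul_one_sub_deleteEdges_pair_eq [Fintype V] [DecidableEq V] (hG : G.IsRegularOfDegree d) {u v : V}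
    (huv : G.Adj u v) (t μ : ℝ) :
    t • (1 : Matrix V V ℝ) - (G.deleteEdges {s(u, v)}).adjMatrix ℝ
        + μ • _root_.degMatrix (G.deleteEdges {s(u, v)}) =
      ((t + μ * d) • (1 : Matrix V V ℝ) - G.adjMatrix ℝ)
        + pairIndicator u v * (!![-μ, 1; 1, -μ] * (pairIndicator u v)ᵀ) := by
  have hne := huv.ne
  ext i j
  simp only [Matrix.add_apply, Matrix.sub_apply, Matrix.smul_apply, _root_.degMatrix, diagonal_apply,
    degree_deleteEdges_pair huv, adjMatrix_deleteEdges_pair_apply huv, hG.degree_eq,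
    Matrix.mul_apply, Fin.sum_univ_two, pairIndicator, of_apply, transpose_apply, one_apply,
    smul_eq_mul]
  simp only [cons_val_zero, cons_val_one, cons_val', cons_val_fin_one]
  obtain rfl | hij := eq_or_ne i j
  · split_ifs <;> first | (exfalso; grind) | (simp; try ring)
  · split_ifs <;> first | (exfalso; grind) | (simp; try ring)

theorem IsSRGWith.det_smul_one_sub_deleteEdges_pair [Fintype V] [DecidableEq V] (hG : G.IsSRGWith n d a c) (t μ : ℝ)
    (hs : ((t + μ * d) • (1 : Matrix V V ℝ) - G.adjMatrix ℝ).det ≠ 0) :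
    ∃ r : ℝ, ∀ u v : V, G.Adj u v →
      (t • (1 : Matrix V V ℝ) - (G.deleteEdges {s(u, v)}).adjMatrix ℝ
        + μ • _root_.degMatrix (G.deleteEdges {s(u, v)})).det = r := by
  obtain ⟨x, y, z, hxyz⟩ := hG.exists_inv_smul_one_sub_adjMatrix_eq _ hs.isUnit
  refine ⟨((t + μ * d) • (1 : Matrix V V ℝ) - G.adjMatrix ℝ).det *
    (1 + !![-μ, 1; 1, -μ] * !![x + z, y + z; y + z, x + z]).det, fun u v huv => ?_⟩
  rw [hG.regular.smul_one_sub_deleteEdges_pair_eq huv, det_add_mul _ _ hs.isUnit, ← hxyz,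
    Matrix.mul_assoc, Matrix.mul_assoc, ← Matrix.mul_assoc _ᵀ, transpose_pairIndicator_mul_mul]
  simp [huv, huv.symm, huv.ne, huv.ne.symm]

end SimpleGraph

theorem stmt9 {V : Type*} [Fintype V] [DecidableEq V]
    (G : SimpleGraph V) (n d a c : ℕ)
    (hG : G.IsSRGWith n d a c)
    (e f : Sym2 V) (he : e ∈ G.edgeSet) (hf : f ∈ G.edgeSet) :
    ∀ t μ : ℝ,
      (t • (1 : Matrix V V ℝ) - (G.deleteEdges {e}).adjMatrix ℝ
          + μ • degMatrix (G.deleteEdges {e})).det =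
      (t • (1 : Matrix V V ℝ) - (G.deleteEdges {f}).adjMatrix ℝ
          + μ • degMatrix (G.deleteEdges {f})).det := by
  intro t μ
  induction e with | _ u v
  induction f with | _ w x
  have h_eval (M D : Matrix V V ℝ) (s : ℝ) :
      (s • (1 : Matrix V V ℝ) - M + μ • D).det = (M - μ • D).charpoly.eval s := by
    rw [eval_charpoly, scalar_apply, ← smul_one_eq_diagonal, sub_add]
  rw [h_eval, h_eval]
  congr 1
  refine mul_left_cancel₀ (charpoly_monic (G.adjMatrix ℝ - μ • ((d : ℝ) • 1))).ne_zero ?_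
  refine Polynomial.funext fun s => ?_
  rw [Polynomial.eval_mul, Polynomial.eval_mul]
  by_cases hs : (G.adjMatrix ℝ - μ • ((d : ℝ) • 1)).charpoly.eval s = 0
  · rw [hs, zero_mul, zero_mul]
  · congr 1
    rw [← h_eval, smul_smul, sub_add_eq_add_sub, ← add_smul] at hs
    obtain ⟨r, hr⟩ := hG.det_smul_one_sub_deleteEdges_pair s μ hs
    rw [← h_eval, ← h_eval, hr u v he, hr w x hf]
end
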